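/- arXiv:1602.04318 — 3 statements merged into one kernel-verified Lean document; each statement's English description precedes it below -/
import Mathlib

section
/- Suppose in addition that lim_{|x|→∞} |x|^{α} a(x) = a₀ for some a₀ > 0, and that for every δ > 0 there exists R > 0 with |∇A(x)|² ≤ ((2−α)/(N−α) + δ) a(x) A(x) for all |x| ≥ R. Then for every ε > 0 and every integer k ≥ 0 there exist constants β > 0, c₀ ≥ 0, t₀ > 0 and C > 0 (with C depending on N, k, R₀, ε) such that, writing Ã := A + c₀, every smooth classical solution u of the damped wave equation satisfies for all t ≥ 0: ∫_Ω Φ_{Ã,β}(x,t) a(x) |∂_t^k u(x,t)|² dx ≤ C (t₀+t)^{−(N−α)/(2−α) − 2k + ε} ‖(u₀,u₁)‖²_{H^{k+1}×H^k} and ∫_Ω Φ_{Ã,β}(x,t) |∇_x ∂_t^k u(x,t)|² dx ≤ C (t₀+t)^{−(N−α)/(2−α) − 2k − 1 + ε} ‖(u₀,u₁)‖²_{H^{k+1}×H^k}, where ‖(u₀,u₁)‖²_{H^{k+1}×H^k} := Σ_{|γ|≤k+1} ∫_Ω |∂^γ u₀|² dx + Σ_{|γ|≤k} ∫_Ω |∂^γ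 u₁|² dx. -/
open MeasureTheory Real

/-- The Laplacian of `f : ℝ^N → ℝ`, as the sum of the second partial derivatives. -/
noncomputable def lap {N : ℕ} (f : EuclideanSpace ℝ (Fin N) → ℝ)
    (x : EuclideanSpace ℝ (Fin N)) : ℝ :=
  ∑ i : Fin N, fderiv ℝ (fun y => fderiv ℝ f y (EuclideanSpace.single i 1)) x
    (EuclideanSpace.single i 1)

open Filter Topology

section IntegrationByParts

variable {E : Type*} [NormedAddCommGroup E] [NormedSpace ℝ E]

/-- A smooth function of one real variable, flat at the origin, that approximates the identity as
`c → 0`. -/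
noncomputable def flatId (c s : ℝ) : ℝ := s ^ 3 / (s ^ 2 + c)

/-- The derivative of `flatId c`. -/
noncomputable def flatId' (c s : ℝ) : ℝ := (s ^ 4 + 3 * c * s ^ 2) / (s ^ 2 + c) ^ 2

lemma hasDerivAt_flatId {c : ℝ} (hc : 0 < c) (s : ℝ) :
    HasDerivAt (flatId c) (flatId' c s) s := by
  have h : s ^ 2 + c ≠ 0 := by positivity
  have := (hasDerivAt_pow 3 s).div ((hasDerivAt_pow 2 s).add_const c) h
  refine this.congr_deriv ?_
  unfold flatId'
  congr 1
  push_cast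
  ring

lemma abs_flatId_le {c : ℝ} (hc : 0 < c) (s : ℝ) : |flatId c s| ≤ |s| := by
  have h : 0 < s ^ 2 + c := by positivity
  rw [flatId, abs_div, abs_of_pos h, div_le_iff₀ h, abs_pow, pow_succ, sq_abs, mul_comm]
  gcongr
  linarith

lemma abs_flatId'_le {c : ℝ} (hc : 0 < c) (s : ℝ) : |flatId' c s| ≤ 3 := by
  have h : 0 < (s ^ 2 + c) ^ 2 := by positivity
  rw [flatId', abs_of_nonneg (by positivity), div_le_iff₀ h]
  nlinarith [sq_nonneg s, sq_nonneg (s ^ 2), sq_nonneg c, mul_nonneg hc.le (sq_nonneg s)]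

lemma continuous_flatId {c : ℝ} (hc : 0 < c) : Continuous (flatId c) :=
  continuous_iff_continuousAt.2 fun s => (hasDerivAt_flatId hc s).continuousAt

lemma continuous_flatId' {c : ℝ} (hc : 0 < c) : Continuous (flatId' c) := by
  unfold flatId'
  refine Continuous.div (by fun_prop) (by fun_prop) fun s => by positivity

lemma tendsto_flatId (s : ℝ) : Tendsto (fun c => flatId c s) (𝓝[>] 0) (𝓝 s) := by
  rcases eq_or_ne s 0 with rfl | hs
  · simp [flatId]
  · have h : Tendsto (fun c : ℝ => s ^ 3 / (s ^ 2 + c)) (𝓝 0) (𝓝 (s ^ 3 / (s ^ 2 + 0))) :=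
      (tendsto_const_nhds.div (tendsto_const_nhds.add tendsto_id) (by positivity))
    have h2 : s ^ 3 / (s ^ 2 + 0) = s := by field_simp; ring
    rw [h2] at h
    exact h.mono_left nhdsWithin_le_nhds

lemma tendsto_flatId' (s : ℝ) :
    Tendsto (fun c => flatId' c s) (𝓝[>] 0) (𝓝 (if s = 0 then 0 else 1)) := by
  split_ifs with hs
  · subst hs
    simp [flatId']
  · have h : Tendsto (fun c : ℝ => (s ^ 4 + 3 * c * s ^ 2) / (s ^ 2 + c) ^ 2) (𝓝 0)
        (𝓝 ((s ^ 4 + 3 * 0 * s ^ 2) / (s ^ 2 + 0) ^ 2)) := by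
      refine Tendsto.div ?_ ?_ (by positivity)
      · exact Continuous.tendsto (by fun_prop) 0
      · exact Continuous.tendsto (by fun_prop) 0
    have h2 : (s ^ 4 + 3 * 0 * s ^ 2) / (s ^ 2 + 0) ^ 2 = 1 := by field_simp; ring
    rw [h2] at h
    exact h.mono_left nhdsWithin_le_nhds

lemma hasFDerivAt_indicator_flatId {Ω : Set E} (hΩ : IsOpen Ω) {f : E → ℝ}
    (hf : Differentiable ℝ f) (h0 : ∀ x ∈ frontier Ω, f x = 0) {c : ℝ} (hc : 0 < c) (x : E) :
    HasFDerivAt (Ω.indicator fun y => flatId c (f y))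
      (Ω.indicator (fun y => flatId' c (f y) • fderiv ℝ f y) x) x := by
  have hcomp : HasFDerivAt (fun y => flatId c (f y)) (flatId' c (f x) • fderiv ℝ f x) x :=
    (hasDerivAt_flatId hc (f x)).comp_hasFDerivAt x (hf x).hasFDerivAt
  by_cases hx : x ∈ Ω
  · rw [Set.indicator_of_mem hx]
    refine hcomp.congr_of_eventuallyEq ?_
    filter_upwards [hΩ.mem_nhds hx] with y hy using Set.indicator_of_mem hy _
  rw [Set.indicator_of_notMem hx]
  by_cases hx' : x ∈ closure Ω
  · have hfx : f x = 0 := h0 x ⟨hx', by rwa [hΩ.interior_eq]⟩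
    have h1 := hcomp.isLittleO
    simp only [hfx, flatId', flatId] at h1
    refine HasFDerivAt.of_isLittleO (Asymptotics.IsBigO.trans_isLittleO ?_ h1)
    refine Asymptotics.IsBigO.of_bound 1 (Eventually.of_forall fun y => ?_)
    by_cases hy : y ∈ Ω
    · simp [Set.indicator_of_mem hy, Set.indicator_of_notMem hx, flatId]
    · simp [Set.indicator_of_notMem hy, Set.indicator_of_notMem hx]
      positivity
  · refine (hasFDerivAt_const (0 : ℝ) x).congr_of_eventuallyEq ?_
    filter_upwards [isClosed_closure.isOpen_compl.mem_nhds hx'] with y hy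
    exact Set.indicator_of_notMem (fun h => hy (subset_closure h)) _

variable [FiniteDimensional ℝ E] [MeasurableSpace E] [BorelSpace E] {μ : Measure E}
  [μ.IsAddHaarMeasure]

/-- Integration by parts against a smooth function, where the critical part of the zero set of
`f` is left out. -/
lemma setIntegral_fderiv_off_zero {Ω : Set E} (hΩ : IsOpen Ω) {f ψ : E → ℝ}
    (hf : ContDiff ℝ 1 f) (hfc : HasCompactSupport f) (h0 : ∀ x ∈ frontier Ω, f x = 0)
    (hψ : ContDiff ℝ 1 ψ) (e : E) :
    ∫ x in Ω, (if f x = 0 then 0 else fderiv ℝ f x e) * ψ x ∂μ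
      = - ∫ x in Ω, f x * fderiv ℝ ψ x e ∂μ := by
  have hf' : Continuous fun x => fderiv ℝ f x e :=
    (hf.continuous_fderiv one_ne_zero).clm_apply continuous_const
  have hψ' : Continuous fun x => fderiv ℝ ψ x e :=
    (hψ.continuous_fderiv one_ne_zero).clm_apply continuous_const
  have hfc' : HasCompactSupport fun x => fderiv ℝ f x e := hfc.fderiv_apply ℝ e
  have key : ∀ c > (0 : ℝ), ∫ x in Ω, (flatId' c (f x) * fderiv ℝ f x e) * ψ x ∂μ
      = - ∫ x in Ω, flatId c (f x) * fderiv ℝ ψ x e ∂μ := by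
    intro c hc
    have hd := hasFDerivAt_indicator_flatId hΩ (hf.differentiable one_ne_zero) h0 hc
    have e1 : ∀ x, fderiv ℝ (Ω.indicator fun y => flatId c (f y)) x e * ψ x
        = Ω.indicator (fun x => (flatId' c (f x) * fderiv ℝ f x e) * ψ x) x := by
      intro x
      rw [(hd x).fderiv]
      by_cases hx : x ∈ Ω <;> simp [hx]
    have e2 : ∀ (g : E → ℝ) x, (Ω.indicator fun y => flatId c (f y)) x * g x
        = Ω.indicator (fun x => flatId c (f x) * g x) x := by
      intro g x
      by_cases hx : x ∈ Ω <;> simp [hx]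
    have e3 := e2 fun x => fderiv ℝ ψ x e
    have e4 := e2 ψ
    have hcs : HasCompactSupport fun x => flatId c (f x) :=
      hfc.comp_left (g := flatId c) (by simp [flatId])
    have hcf := (continuous_flatId hc).comp hf.continuous
    have := integral_mul_fderiv_eq_neg_fderiv_mul_of_integrable (μ := μ) (𝕜 := ℝ)
      (f := Ω.indicator fun y => flatId c (f y)) (g := ψ) (v := e) ?_ ?_ ?_
      (fun x _ => (hd x).differentiableAt) (fun x _ => hψ.differentiable one_ne_zero x)
    · simp only [e1, e3] at this
      rw [integral_indicator hΩ.measurableSet, integral_indicator hΩ.measurableSet] at this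
      linarith
    · simp only [e1]
      refine Integrable.indicator ?_ hΩ.measurableSet
      refine Continuous.integrable_of_hasCompactSupport ?_ ?_
      · exact (((continuous_flatId' hc).comp hf.continuous).mul hf').mul hψ.continuous
      · exact (hfc'.mul_left).mul_right
    · simp only [e3]
      refine Integrable.indicator ?_ hΩ.measurableSet
      exact Continuous.integrable_of_hasCompactSupport (hcf.mul hψ') hcs.mul_right
    · simp only [e4]
      refine Integrable.indicator ?_ hΩ.measurableSet
      exact Continuous.integrable_of_hasCompactSupport (hcf.mul hψ.continuous) hcs.mul_right
  have hpos : ∀ᶠ c : ℝ in 𝓝[>] 0, 0 < c := self_mem_nhdsWithin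
  have l1 : Tendsto (fun c : ℝ => ∫ x in Ω, (flatId' c (f x) * fderiv ℝ f x e) * ψ x ∂μ) (𝓝[>] 0)
      (𝓝 (∫ x in Ω, (if f x = 0 then 0 else fderiv ℝ f x e) * ψ x ∂μ)) := by
    refine tendsto_integral_filter_of_dominated_convergence
      (fun x => 3 * ‖fderiv ℝ f x e * ψ x‖) ?_ ?_ ?_ ?_
    · filter_upwards [hpos] with c hc
      exact ((((continuous_flatId' hc).comp hf.continuous).mul hf').mul
        hψ.continuous).aestronglyMeasurable
    · filter_upwards [hpos] with c hc
      refine Eventually.of_forall fun x => ?_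
      rw [mul_assoc, norm_mul]
      gcongr
      exact abs_flatId'_le hc _
    · refine Integrable.const_mul (Integrable.norm ?_) _
      exact (Continuous.integrable_of_hasCompactSupport (hf'.mul hψ.continuous)
        hfc'.mul_right).integrableOn
    · refine Eventually.of_forall fun x => ?_
      refine Tendsto.mul_const _ ?_
      have := (tendsto_flatId' (f x)).mul_const (fderiv ℝ f x e)
      simpa [ite_mul] using this
  have l2 : Tendsto (fun c : ℝ => - ∫ x in Ω, flatId c (f x) * fderiv ℝ ψ x e ∂μ) (𝓝[>] 0)
      (𝓝 (- ∫ x in Ω, f x * fderiv ℝ ψ x e ∂μ)) := by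
    refine Tendsto.neg (tendsto_integral_filter_of_dominated_convergence
      (fun x => ‖f x * fderiv ℝ ψ x e‖) ?_ ?_ ?_ ?_)
    · filter_upwards [hpos] with c hc
      exact (((continuous_flatId hc).comp hf.continuous).mul hψ').aestronglyMeasurable
    · filter_upwards [hpos] with c hc
      refine Eventually.of_forall fun x => ?_
      rw [norm_mul, norm_mul]
      gcongr
      exact abs_flatId_le hc _
    · refine Integrable.norm ?_
      exact (Continuous.integrable_of_hasCompactSupport (hf.continuous.mul hψ')
        hfc.mul_right).integrableOn
    · exact Eventually.of_forall fun x => (tendsto_flatId (f x)).mul_const _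
  refine tendsto_nhds_unique_of_eventuallyEq l1 l2 ?_
  filter_upwards [hpos] with c hc using key c hc

/-- The derivative of a `C¹` function vanishes almost everywhere on its zero set. -/
lemma ae_fderiv_eq_zero_of_eq_zero {f : E → ℝ} (hf : ContDiff ℝ 1 f) (hfc : HasCompactSupport f)
    (e : E) : ∀ᵐ x ∂μ, f x = 0 → fderiv ℝ f x e = 0 := by
  have hf' : Continuous fun x => fderiv ℝ f x e :=
    (hf.continuous_fderiv one_ne_zero).clm_apply continuous_const
  have hfc' : HasCompactSupport fun x => fderiv ℝ f x e := hfc.fderiv_apply ℝ e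
  have hI : Integrable (fun x => fderiv ℝ f x e) μ := hf'.integrable_of_hasCompactSupport hfc'
  have hm : MeasurableSet {x | f x = 0} := (isClosed_eq hf.continuous continuous_const).measurableSet
  have hI2 : Integrable (fun x => if f x = 0 then 0 else fderiv ℝ f x e) μ := by
    have := hI.indicator hm.compl
    refine this.congr (Eventually.of_forall fun x => ?_)
    by_cases hx : f x = 0 <;> simp [hx]
  have hz : ∀ᵐ x ∂μ, fderiv ℝ f x e - (if f x = 0 then 0 else fderiv ℝ f x e) = 0 := by
    refine ae_eq_zero_of_integral_contDiff_smul_eq_zero (hI.sub hI2).locallyIntegrable ?_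
    intro g hg hgc
    have hg1 : ContDiff ℝ 1 g := hg.of_le (by exact_mod_cast le_top)
    have hg' : Continuous fun x => fderiv ℝ g x e :=
      (hg1.continuous_fderiv one_ne_zero).clm_apply continuous_const
    have a1 := setIntegral_fderiv_off_zero (μ := μ) isOpen_univ hf hfc (by simp) hg1 e
    have a2 := integral_mul_fderiv_eq_neg_fderiv_mul_of_integrable (μ := μ) (𝕜 := ℝ)
      (f := f) (g := g) (v := e)
      ((hf'.mul hg1.continuous).integrable_of_hasCompactSupport hfc'.mul_right)
      ((hf.continuous.mul hg').integrable_of_hasCompactSupport hfc.mul_right)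
      ((hf.continuous.mul hg1.continuous).integrable_of_hasCompactSupport hfc.mul_right)
      (fun x _ => hf.differentiable one_ne_zero x) (fun x _ => hg1.differentiable one_ne_zero x)
    simp only [setIntegral_univ] at a1
    have b1 : Integrable (fun x => fderiv ℝ f x e * g x) μ :=
      (hf'.mul hg1.continuous).integrable_of_hasCompactSupport hfc'.mul_right
    have b2 : Integrable (fun x => (if f x = 0 then 0 else fderiv ℝ f x e) * g x) μ := by
      have := b1.indicator hm.compl
      refine this.congr (Eventually.of_forall fun x => ?_)
      by_cases hx : f x = 0 <;> simp [hx]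
    have : ∀ x, g x • (fderiv ℝ f x e - (if f x = 0 then 0 else fderiv ℝ f x e))
        = fderiv ℝ f x e * g x - (if f x = 0 then 0 else fderiv ℝ f x e) * g x := by
      intro x; simp only [smul_eq_mul]; ring
    simp only [this]
    rw [integral_sub b1 b2, a1, a2]
    ring
  filter_upwards [hz] with x hx h0
  simpa [h0] using hx

/-- The divergence theorem, one direction at a time, for functions vanishing on the boundary of an
arbitrary open set. -/
theorem setIntegral_fderiv_eq_zero_of_frontier {Ω : Set E} (hΩ : IsOpen Ω) {f : E → ℝ}
    (hf : ContDiff ℝ 1 f) (hfc : HasCompactSupport f) (h0 : ∀ x ∈ frontier Ω, f x = 0) (e : E) :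
    ∫ x in Ω, fderiv ℝ f x e ∂μ = 0 := by
  have h1 := setIntegral_fderiv_off_zero (μ := μ) hΩ hf hfc h0 (ψ := fun _ => 1) contDiff_const e
  have h2 := ae_fderiv_eq_zero_of_eq_zero (μ := μ) hf hfc e
  simp only [mul_one, fderiv_fun_const, Pi.zero_apply, zero_apply, mul_zero,
    integral_zero, neg_zero] at h1
  rw [← h1]
  refine integral_congr_ae (ae_restrict_of_ae ?_)
  filter_upwards [h2] with x hx
  by_cases h : f x = 0
  · simp [h, hx h]
  · simp [h]

end IntegrationByParts

section FinitePropagation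

lemma continuous_slice {E : Type*} [TopologicalSpace E] {F : E → ℝ → ℝ}
    (hF : ContinuousOn (fun p : E × ℝ => F p.1 p.2) (Set.univ ×ˢ Set.Ioi (-1))) {s : ℝ}
    (hs : -1 < s) : Continuous fun x => F x s :=
  hF.comp_continuous (f := fun x => (x, s)) (by fun_prop) fun _ => ⟨trivial, hs⟩

variable {E : Type*} [NormedAddCommGroup E] [NormedSpace ℝ E] [FiniteDimensional ℝ E]
  [MeasurableSpace E] [BorelSpace E] {μ : Measure E} [IsFiniteMeasureOnCompacts μ]

lemma exists_bound_of_finite_propagation {F : E → ℝ → ℝ} {R₀ : ℝ}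
    (hF : ContinuousOn (fun p : E × ℝ => F p.1 p.2) (Set.univ ×ˢ Set.Ioi (-1)))
    (hsupp : ∀ s ≥ (0 : ℝ), ∀ x, R₀ + s < ‖x‖ → F x s = 0) (t : ℝ) :
    ∃ bound : E → ℝ, Integrable bound μ ∧ ∀ s ∈ Set.Icc 0 (t + 1), ∀ x, ‖F x s‖ ≤ bound x := by
  have hK : IsCompact (Metric.closedBall (0 : E) (R₀ + (t + 1)) ×ˢ Set.Icc (0 : ℝ) (t + 1)) :=
    (isCompact_closedBall 0 _).prod isCompact_Icc
  obtain ⟨C, hC⟩ := hK.exists_bound_of_continuousOn (hF.mono (by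
    rintro ⟨x, s⟩ ⟨-, hs⟩
    exact ⟨trivial, lt_of_lt_of_le (by norm_num) hs.1⟩))
  refine ⟨(Metric.closedBall (0 : E) (R₀ + (t + 1))).indicator fun _ => |C|, ?_, ?_⟩
  · exact (integrable_indicator_iff measurableSet_closedBall).2
      (integrableOn_const (isCompact_closedBall _ _).measure_lt_top.ne)
  · intro s hs x
    by_cases hx : x ∈ Metric.closedBall (0 : E) (R₀ + (t + 1))
    · rw [Set.indicator_of_mem hx]
      exact (hC (x, s) ⟨hx, hs⟩).trans (le_abs_self C)
    · rw [Set.indicator_of_notMem hx, hsupp s hs.1 x, norm_zero]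
      rw [mem_closedBall_zero_iff, not_le] at hx
      linarith [hs.2]

lemma integrable_slice_of_finite_propagation {F : E → ℝ → ℝ} {R₀ : ℝ}
    (hF : ContinuousOn (fun p : E × ℝ => F p.1 p.2) (Set.univ ×ˢ Set.Ioi (-1)))
    (hsupp : ∀ s ≥ (0 : ℝ), ∀ x, R₀ + s < ‖x‖ → F x s = 0) {t : ℝ} (ht : 0 ≤ t) :
    Integrable (fun x => F x t) μ := by
  obtain ⟨b, hb, hFb⟩ := exists_bound_of_finite_propagation (μ := μ) hF hsupp t
  exact hb.mono' (continuous_slice hF (by linarith)).aestronglyMeasurable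
    (Eventually.of_forall (hFb t ⟨ht, by linarith⟩))

lemma continuousOn_setIntegral_of_finite_propagation {F : E → ℝ → ℝ} {R₀ : ℝ}
    (hF : ContinuousOn (fun p : E × ℝ => F p.1 p.2) (Set.univ ×ˢ Set.Ioi (-1)))
    (hsupp : ∀ s ≥ (0 : ℝ), ∀ x, R₀ + s < ‖x‖ → F x s = 0) (Ω : Set E) :
    ContinuousOn (fun t => ∫ x in Ω, F x t ∂μ) (Set.Ici 0) := by
  intro t ht
  obtain ⟨b, hb, hFb⟩ := exists_bound_of_finite_propagation (μ := μ) hF hsupp t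
  have hev : ∀ᶠ s in 𝓝[Set.Ici 0] t, s ∈ Set.Icc 0 (t + 1) := by
    filter_upwards [self_mem_nhdsWithin, mem_nhdsWithin_of_mem_nhds (Iio_mem_nhds (lt_add_one t))]
      with s h1 h2 using ⟨h1, h2.le⟩
  refine continuousWithinAt_of_dominated (bound := b) ?_ ?_ hb.integrableOn ?_
  · filter_upwards [hev] with s hs
    exact (continuous_slice hF (by linarith [hs.1])).aestronglyMeasurable
  · filter_upwards [hev] with s hs using Eventually.of_forall (hFb s hs)
  · refine Eventually.of_forall fun x => ContinuousAt.continuousWithinAt ?_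
    have h1 : ContinuousAt (fun p : E × ℝ => F p.1 p.2) (x, t) :=
      hF.continuousAt ((isOpen_univ.prod isOpen_Ioi).mem_nhds
        ⟨trivial, show (-1 : ℝ) < t from lt_of_lt_of_le (by norm_num) (show (0 : ℝ) ≤ t from ht)⟩)
    exact ContinuousAt.comp (f := fun s : ℝ => (x, s)) (x := t) h1 (by fun_prop)

lemma hasDerivAt_setIntegral_of_finite_propagation {F F' : E → ℝ → ℝ} {R₀ : ℝ}
    (hF : ContinuousOn (fun p : E × ℝ => F p.1 p.2) (Set.univ ×ˢ Set.Ioi (-1)))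
    (hF' : ContinuousOn (fun p : E × ℝ => F' p.1 p.2) (Set.univ ×ˢ Set.Ioi (-1)))
    (hsupp : ∀ s ≥ (0 : ℝ), ∀ x, R₀ + s < ‖x‖ → F x s = 0)
    (hsupp' : ∀ s ≥ (0 : ℝ), ∀ x, R₀ + s < ‖x‖ → F' x s = 0)
    (hd : ∀ x, ∀ s > 0, HasDerivAt (F x) (F' x s) s) (Ω : Set E) {t : ℝ} (ht : 0 < t) :
    HasDerivAt (fun t => ∫ x in Ω, F x t ∂μ) (∫ x in Ω, F' x t ∂μ) t := by
  obtain ⟨b, hb, hFb⟩ := exists_bound_of_finite_propagation (μ := μ) hF' hsupp' t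
  have hev : Set.Ioo 0 (t + 1) ∈ 𝓝 t := Ioo_mem_nhds ht (lt_add_one t)
  refine (hasDerivAt_integral_of_dominated_loc_of_deriv_le (bound := b)
    (F := fun s x => F x s) (F' := fun s x => F' x s) hev ?_ ?_ ?_ ?_ hb.integrableOn ?_).2
  · filter_upwards [hev] with s hs
    exact (continuous_slice hF (by linarith [hs.1])).aestronglyMeasurable
  · exact (integrable_slice_of_finite_propagation hF hsupp ht.le).integrableOn
  · exact (continuous_slice hF' (by linarith)).aestronglyMeasurable
  · exact Eventually.of_forall fun x s hs => hFb s ⟨hs.1.le, hs.2.le⟩ x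
  · exact Eventually.of_forall fun x s hs => hd x s hs.1

end FinitePropagation

section DirectionalDerivative

variable {X : Type*} [NormedAddCommGroup X] [NormedSpace ℝ X]

/-- The derivative of `V` in the direction `w`, as a function. -/
noncomputable def dirDeriv (w : X) (V : X → ℝ) : X → ℝ := fun p => fderiv ℝ V p w

lemma ContDiff.dirDeriv {V : X → ℝ} (hV : ContDiff ℝ (⊤ : ℕ∞) V) (w : X) :
    ContDiff ℝ (⊤ : ℕ∞) (dirDeriv w V) :=
  (hV.fderiv_right (m := (⊤ : ℕ∞)) (by simp)).clm_apply contDiff_const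

lemma dirDeriv_comm {V : X → ℝ} (hV : ContDiff ℝ (⊤ : ℕ∞) V) (w w' : X) :
    dirDeriv w (dirDeriv w' V) = dirDeriv w' (dirDeriv w V) := by
  funext p
  have hd : DifferentiableAt ℝ (fderiv ℝ V) p :=
    ((hV.fderiv_right (m := (⊤ : ℕ∞)) (by simp)).differentiable (by simp)) p
  have hs : IsSymmSndFDerivAt ℝ V p :=
    hV.contDiffAt.isSymmSndFDerivAt (by
      rw [minSmoothness_of_isRCLikeNormedField]
      exact WithTop.coe_le_coe.2 (le_top : (2 : ℕ∞) ≤ ⊤))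
  have h1 : ∀ v v' : X, dirDeriv v (dirDeriv v' V) p = fderiv ℝ (fderiv ℝ V) p v v' := by
    intro v v'
    unfold dirDeriv
    rw [fderiv_clm_apply hd (differentiableAt_const _)]
    simp
  rw [h1, h1]
  exact hs w w'

lemma ContDiff.differentiable_of_top {V : X → ℝ} (hV : ContDiff ℝ (⊤ : ℕ∞) V) :
    Differentiable ℝ V := hV.differentiable (by simp)

end DirectionalDerivative

section SpaceTime

variable {N : ℕ}

/-- The time derivative of a function on space-time. -/
noncomputable def timeD (V : EuclideanSpace ℝ (Fin N) × ℝ → ℝ) : EuclideanSpace ℝ (Fin N) × ℝ → ℝ :=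
  dirDeriv (0, 1) V

/-- The `i`-th spatial partial derivative of a function on space-time. -/
noncomputable def spaceD (i : Fin N) (V : EuclideanSpace ℝ (Fin N) × ℝ → ℝ) :
    EuclideanSpace ℝ (Fin N) × ℝ → ℝ :=
  dirDeriv (EuclideanSpace.single i 1, 0) V

lemma hasDerivAt_timeD {V : EuclideanSpace ℝ (Fin N) × ℝ → ℝ} (hV : Differentiable ℝ V)
    (x : EuclideanSpace ℝ (Fin N)) (s : ℝ) :
    HasDerivAt (fun s => V (x, s)) (timeD V (x, s)) s := by
  have h1 : HasDerivAt (fun s : ℝ => (x, s)) ((0 : EuclideanSpace ℝ (Fin N)), (1 : ℝ)) s :=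
    (hasDerivAt_const s x).prodMk (hasDerivAt_id s)
  exact (hV (x, s)).hasFDerivAt.comp_hasDerivAt s h1

lemma hasFDerivAt_slice {V : EuclideanSpace ℝ (Fin N) × ℝ → ℝ} (hV : Differentiable ℝ V)
    (x : EuclideanSpace ℝ (Fin N)) (s : ℝ) :
    HasFDerivAt (fun y => V (y, s))
      ((fderiv ℝ V (x, s)).comp (ContinuousLinearMap.inl ℝ (EuclideanSpace ℝ (Fin N)) ℝ)) x :=
  (hV (x, s)).hasFDerivAt.comp x (hasFDerivAt_prodMk_left x s)

lemma fderiv_slice_single {V : EuclideanSpace ℝ (Fin N) × ℝ → ℝ} (hV : Differentiable ℝ V)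
    (x : EuclideanSpace ℝ (Fin N)) (s : ℝ) (i : Fin N) :
    fderiv ℝ (fun y => V (y, s)) x (EuclideanSpace.single i 1) = spaceD i V (x, s) := by
  rw [(hasFDerivAt_slice hV x s).fderiv]
  simp [spaceD, dirDeriv]

lemma lap_slice {V : EuclideanSpace ℝ (Fin N) × ℝ → ℝ} (hV : ContDiff ℝ (⊤ : ℕ∞) V)
    (x : EuclideanSpace ℝ (Fin N)) (s : ℝ) :
    lap (fun y => V (y, s)) x = ∑ i, spaceD i (spaceD i V) (x, s) := by
  unfold lap
  refine Finset.sum_congr rfl fun i _ => ?_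
  simp only [fderiv_slice_single hV.differentiable_of_top]
  exact fderiv_slice_single (hV.dirDeriv _).differentiable_of_top x s i

lemma norm_sq_eq_sum_single (L : EuclideanSpace ℝ (Fin N) →L[ℝ] ℝ) :
    ‖L‖ ^ 2 = ∑ i, L (EuclideanSpace.single i 1) ^ 2 := by
  have h := (InnerProductSpace.toDual ℝ (EuclideanSpace ℝ (Fin N))).symm.norm_map L
  rw [← h, EuclideanSpace.norm_sq_eq]
  refine Finset.sum_congr rfl fun i _ => ?_
  rw [Real.norm_eq_abs, sq_abs]
  congr 1
  have := InnerProductSpace.toDual_symm_apply (𝕜 := ℝ) (x := EuclideanSpace.single i (1 : ℝ)) (y := L)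
  rw [← this, EuclideanSpace.inner_single_right]
  simp

lemma norm_gradient_sq (f : EuclideanSpace ℝ (Fin N) → ℝ) (x : EuclideanSpace ℝ (Fin N)) :
    ‖gradient f x‖ ^ 2 = ∑ i, fderiv ℝ f x (EuclideanSpace.single i 1) ^ 2 := by
  rw [gradient, LinearIsometryEquiv.norm_map, norm_sq_eq_sum_single]

/-- A smooth function on space-time solving the damped wave equation on `Ω`, vanishing on the
boundary, and propagating with speed at most one. -/
structure IsDampedWave (Ω : Set (EuclideanSpace ℝ (Fin N))) (a : EuclideanSpace ℝ (Fin N) → ℝ)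
    (R₀ : ℝ) (V : EuclideanSpace ℝ (Fin N) × ℝ → ℝ) : Prop where
  smooth : ContDiff ℝ (⊤ : ℕ∞) V
  eqn : ∀ x ∈ Ω, ∀ s > (0 : ℝ),
    timeD (timeD V) (x, s) - ∑ i, spaceD i (spaceD i V) (x, s) + a x * timeD V (x, s) = 0
  bdry : ∀ x ∈ frontier Ω, ∀ s > (0 : ℝ), V (x, s) = 0
  supp : ∀ s ≥ (0 : ℝ), ∀ x, R₀ + s < ‖x‖ → V (x, s) = 0

lemma timeD_eq_zero_of_pos {V : EuclideanSpace ℝ (Fin N) × ℝ → ℝ} (hV : Differentiable ℝ V)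
    {x : EuclideanSpace ℝ (Fin N)} {U : Set ℝ} (hU : IsOpen U) (h : ∀ s ∈ U, V (x, s) = 0)
    {s : ℝ} (hs : s ∈ U) : timeD V (x, s) = 0 := by
  have h1 : HasDerivAt (fun s => V (x, s)) 0 s := by
    refine (hasDerivAt_const s (0 : ℝ)).congr_of_eventuallyEq ?_
    filter_upwards [hU.mem_nhds hs] with r hr using h r hr
  exact (hasDerivAt_timeD hV x s).unique h1

lemma eq_zero_at_zero_of_pos {f : ℝ → ℝ} (hf : Continuous f) {ε : ℝ} (hε : 0 < ε)
    (h : ∀ s ∈ Set.Ioo 0 ε, f s = 0) : f 0 = 0 := by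
  have h1 : Tendsto f (𝓝[>] 0) (𝓝 (f 0)) := hf.continuousAt.tendsto.mono_left nhdsWithin_le_nhds
  refine tendsto_nhds_unique_of_eventuallyEq h1 tendsto_const_nhds ?_
  filter_upwards [Ioo_mem_nhdsGT hε] with s hs using h s hs

namespace IsDampedWave

variable {Ω : Set (EuclideanSpace ℝ (Fin N))} {a : EuclideanSpace ℝ (Fin N) → ℝ} {R₀ : ℝ}
  {V : EuclideanSpace ℝ (Fin N) × ℝ → ℝ}

lemma supp_timeD (h : IsDampedWave Ω a R₀ V) :
    ∀ s ≥ (0 : ℝ), ∀ x, R₀ + s < ‖x‖ → timeD V (x, s) = 0 := by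
  intro s hs x hx
  have hpos : ∀ r ∈ Set.Ioo 0 (‖x‖ - R₀), timeD V (x, r) = 0 := fun r hr =>
    timeD_eq_zero_of_pos h.smooth.differentiable_of_top isOpen_Ioo
      (fun q hq => h.supp q hq.1.le x (by linarith [hq.2])) hr
  rcases hs.eq_or_lt with rfl | hs'
  · exact eq_zero_at_zero_of_pos (f := fun r => timeD V (x, r))
      ((h.smooth.dirDeriv _).continuous.comp (by fun_prop)) (by linarith) hpos
  · exact hpos s ⟨hs', by linarith⟩

lemma supp_spaceD (h : IsDampedWave Ω a R₀ V) (i : Fin N) :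
    ∀ s ≥ (0 : ℝ), ∀ x, R₀ + s < ‖x‖ → spaceD i V (x, s) = 0 := by
  intro s hs x hx
  rw [← fderiv_slice_single h.smooth.differentiable_of_top]
  have : (fun y => V (y, s)) =ᶠ[𝓝 x] fun _ => 0 := by
    filter_upwards [(isOpen_lt continuous_const continuous_norm).mem_nhds hx] with y hy
      using h.supp s hs y hy
  rw [this.fderiv_eq]
  simp

lemma time_deriv (h : IsDampedWave Ω a R₀ V) : IsDampedWave Ω a R₀ (timeD V) where
  smooth := h.smooth.dirDeriv _
  bdry x hx _ hs := timeD_eq_zero_of_pos h.smooth.differentiable_of_top isOpen_Ioi (h.bdry x hx) hs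
  supp := h.supp_timeD
  eqn := by
    intro x hx s hs
    have hsm := h.smooth
    have h1 : HasDerivAt (fun s => timeD (timeD V) (x, s)
        - ∑ i, spaceD i (spaceD i V) (x, s) + a x * timeD V (x, s))
        (timeD (timeD (timeD V)) (x, s)
        - ∑ i, timeD (spaceD i (spaceD i V)) (x, s)
          + a x * timeD (timeD V) (x, s)) s := by
      refine HasDerivAt.add (HasDerivAt.sub ?_ ?_) (HasDerivAt.const_mul _ ?_)
      · exact hasDerivAt_timeD ((hsm.dirDeriv _).dirDeriv _).differentiable_of_top x s
      · refine HasDerivAt.fun_sum fun i _ => ?_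
        exact hasDerivAt_timeD ((hsm.dirDeriv _).dirDeriv _).differentiable_of_top x s
      · exact hasDerivAt_timeD (hsm.dirDeriv _).differentiable_of_top x s
    have h2 : HasDerivAt (fun s => timeD (timeD V) (x, s)
        - ∑ i, spaceD i (spaceD i V) (x, s) + a x * timeD V (x, s)) 0 s := by
      refine (hasDerivAt_const s (0 : ℝ)).congr_of_eventuallyEq ?_
      filter_upwards [isOpen_Ioi.mem_nhds hs] with r hr using h.eqn x hx r hr
    rw [← h1.unique h2]
    congr 2
    refine Finset.sum_congr rfl fun i _ => congrFun ?_ (x, s)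
    unfold spaceD timeD
    rw [dirDeriv_comm hsm, dirDeriv_comm (hsm.dirDeriv _)]

lemma iterate_timeD (h : IsDampedWave Ω a R₀ V) (k : ℕ) :
    IsDampedWave Ω a R₀ (timeD^[k] V) := by
  induction k with
  | zero => exact h
  | succ k ih => rw [Function.iterate_succ_apply']; exact ih.time_deriv

lemma eqn_of_nonneg (h : IsDampedWave Ω a R₀ V) {x : EuclideanSpace ℝ (Fin N)} (hx : x ∈ Ω)
    {s : ℝ} (hs : 0 ≤ s) :
    timeD (timeD V) (x, s)
      = ∑ i, spaceD i (spaceD i V) (x, s) - a x * timeD V (x, s) := by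
  have key : timeD (timeD V) (x, s) - ∑ i, spaceD i (spaceD i V) (x, s)
      + a x * timeD V (x, s) = 0 := by
    rcases hs.eq_or_lt with rfl | hs'
    · refine eq_zero_at_zero_of_pos (f := fun r => timeD (timeD V) (x, r)
        - ∑ i, spaceD i (spaceD i V) (x, r) + a x * timeD V (x, r)) ?_ one_pos
        fun r hr => h.eqn x hx r hr.1
      have c1 := (h.smooth.dirDeriv ((0 : EuclideanSpace ℝ (Fin N)), (1 : ℝ))).continuous
      have c2 := ((h.smooth.dirDeriv ((0 : EuclideanSpace ℝ (Fin N)), (1 : ℝ))).dirDeriv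
        ((0 : EuclideanSpace ℝ (Fin N)), (1 : ℝ))).continuous
      have c3 := fun i : Fin N => ((h.smooth.dirDeriv
        (EuclideanSpace.single i (1 : ℝ), (0 : ℝ))).dirDeriv
        (EuclideanSpace.single i (1 : ℝ), (0 : ℝ))).continuous
      refine ((c2.comp (by fun_prop)).sub (continuous_finsetSum _ fun i _ =>
        (c3 i).comp (by fun_prop))).add (continuous_const.mul (c1.comp (by fun_prop)))
    · exact h.eqn x hx s hs'
  linarith

end IsDampedWave

end SpaceTime

/-- The pointwise estimate behind the weighted energy inequality. Here `σ = B / τ²`. -/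
lemma energy_density_le {T τ σ a S p v X G W L β ν η h K Λ M m : ℝ}
    (hτ : 0 < τ) (hτT : τ ≤ T) (hσ : 0 < σ) (ha : 0 < a) (hβ : 0 < β) (hν : 0 < ν)
    (hη : 0 < η) (hη1 : η < 1) (hS : 0 ≤ S) (hm : m < β)
    (hX : ∀ r s : ℝ, 0 ≤ r ^ 2 * S + 2 * r * s * X + s ^ 2 * G)
    (hG : G ≤ h * a * σ) (hσa : σ ≤ K * a) (hΛ1 : 1 ≤ Λ) (hΛ : Λ ≤ a * T)
    (hβh : β * h * (1 + η) ≤ (1 - η) ^ 2) (hβh' : β * h ≤ 1)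
    (hνM : (M + 1) * ν ≤ 2 * η)
    (hbig : (M + 1) * ν + β * K / η + M ^ 2 / (β - m) + 2 ≤ ν / 2 * Λ) :
    M / T * (ν * T * (S + p ^ 2) + 2 * v * p + a * v ^ 2)
      + (-(β * σ) * (ν * T * (S + p ^ 2) + 2 * v * p + a * v ^ 2) + ν * (S + p ^ 2)
        + ν * T * (2 * W + 2 * p * (L - a * p)) + 2 * p ^ 2 + 2 * v * (L - a * p) + 2 * a * v * p)
      - 2 * ν * T * (W + p * L + β * p * X) - 2 * (S + v * L + β * v * X)
      - ((β * a / τ + β ^ 2 * G) * v ^ 2 + 2 * β * v * X)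
    ≤ (M - m) / T * (a * v ^ 2) - ν / 2 * T * (a * p ^ 2) := by
  have hT : 0 < T := hτ.trans_le hτT
  have hκ : 0 < β - m := by linarith
  have hη' : 0 < 1 - η := by linarith
  have hGpos : 0 ≤ G := by simpa using hX 0 1
  -- the cross term between `p` and the gradient
  have t1 : -(2 * p * X) ≤ σ * S + h * a * p ^ 2 := by
    have h1 := hX σ p
    have h2 : p ^ 2 * G ≤ p ^ 2 * (h * a * σ) := by gcongr
    have h3 : 0 ≤ σ * (σ * S + 2 * p * X + h * a * p ^ 2) := by linarith
    linarith [nonneg_of_mul_nonneg_right h3 hσ]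
  have t1' : -(2 * ν * T * (β * p * X)) ≤ ν * T * β * σ * S + ν * T * a * p ^ 2 := by
    have h1 : ν * T * β * (-(2 * p * X)) ≤ ν * T * β * (σ * S + h * a * p ^ 2) := by gcongr
    have h2 : ν * T * a * p ^ 2 * (β * h) ≤ ν * T * a * p ^ 2 * 1 := by gcongr
    linarith
  -- the cross term between `v` and the gradient
  have t2 : -(4 * β * v * X) ≤ 2 * (1 - η) * S + 2 * β ^ 2 * v ^ 2 * G / (1 - η) := by
    have h1 := hX (1 - η) (β * v)
    have h3 : 0 ≤ ((1 - η) ^ 2 * S + 2 * (1 - η) * (β * v) * X + (β * v) ^ 2 * G) / (1 - η) * 2 := by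
      positivity
    have h4 : ((1 - η) ^ 2 * S + 2 * (1 - η) * (β * v) * X + (β * v) ^ 2 * G) / (1 - η) * 2
        = 2 * (1 - η) * S + 4 * β * v * X + 2 * β ^ 2 * v ^ 2 * G / (1 - η) := by
      field_simp
      ring
    linarith
  have t2' : 2 * β ^ 2 * v ^ 2 * G / (1 - η) - β ^ 2 * G * v ^ 2 ≤ (1 - η) * β * a * σ * v ^ 2 := by
    have h1 : 2 * β ^ 2 * v ^ 2 * G / (1 - η) - β ^ 2 * G * v ^ 2
        = β ^ 2 * v ^ 2 * (1 + η) / (1 - η) * G := by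
      field_simp
      ring
    have h2 : β ^ 2 * v ^ 2 * (1 + η) / (1 - η) * G
        ≤ β ^ 2 * v ^ 2 * (1 + η) / (1 - η) * (h * a * σ) := by gcongr
    have h3 : β ^ 2 * v ^ 2 * (1 + η) / (1 - η) * (h * a * σ)
        = β * v ^ 2 * a * σ / (1 - η) * (β * h * (1 + η)) := by
      field_simp
    have h4 : β * v ^ 2 * a * σ / (1 - η) * (β * h * (1 + η))
        ≤ β * v ^ 2 * a * σ / (1 - η) * (1 - η) ^ 2 := by gcongr
    have h5 : β * v ^ 2 * a * σ / (1 - η) * (1 - η) ^ 2 = (1 - η) * β * a * σ * v ^ 2 := by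
      field_simp
    linarith
  have t3 : -(2 * (β * σ) * v * p) ≤ η * β * σ * a * v ^ 2 + β * K / η * p ^ 2 := by
    have h1 : 0 ≤ β * σ / (η * a) * (η * a * v + p) ^ 2 := by positivity
    have h2 : β * σ / (η * a) * (η * a * v + p) ^ 2
        = η * β * σ * a * v ^ 2 + 2 * (β * σ) * v * p + β / (η * a) * σ * p ^ 2 := by
      field_simp
      ring
    have h3 : β / (η * a) * σ * p ^ 2 ≤ β / (η * a) * (K * a) * p ^ 2 := by gcongr
    have h4 : β / (η * a) * (K * a) * p ^ 2 = β * K / η * p ^ 2 := by field_simp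
    linarith
  have t4 : M / T * (2 * v * p) ≤ (β - m) / T * (a * v ^ 2) + M ^ 2 / (β - m) * p ^ 2 := by
    have h1 : 0 ≤ ((β - m) * a * v - M * p) ^ 2 / ((β - m) * a * T) := by positivity
    have h2 : ((β - m) * a * v - M * p) ^ 2 / ((β - m) * a * T)
        = (β - m) / T * (a * v ^ 2) - M / T * (2 * v * p)
          + M ^ 2 / (β - m) * p ^ 2 * (1 / (a * T)) := by
      field_simp
      ring
    have h3 : 1 / (a * T) ≤ 1 := by
      rw [div_le_one (by positivity)]
      linarith
    have h4 : M ^ 2 / (β - m) * p ^ 2 * (1 / (a * T)) ≤ M ^ 2 / (β - m) * p ^ 2 * 1 := by gcongr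
    linarith
  have t5 : β / T * (a * v ^ 2) ≤ β * a / τ * v ^ 2 := by
    have : β / T * (a * v ^ 2) ≤ β / τ * (a * v ^ 2) := by gcongr
    calc _ ≤ _ := this
      _ = _ := by ring
  have t6 : ((M + 1) * ν + β * K / η + M ^ 2 / (β - m) + 2) * p ^ 2 ≤ ν / 2 * (a * T) * p ^ 2 := by
    have : ν / 2 * Λ ≤ ν / 2 * (a * T) := by gcongr
    gcongr
    linarith
  have t7 : (M + 1) * ν * S ≤ 2 * η * S := by gcongr
  have t8 : 0 ≤ β * σ * ν * T * p ^ 2 := by positivity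
  have e1 : M / T * (ν * T * (S + p ^ 2) + 2 * v * p + a * v ^ 2)
      = M * ν * (S + p ^ 2) + M / T * (2 * v * p) + M / T * (a * v ^ 2) := by
    field_simp
  have e2 : (M - m) / T * (a * v ^ 2)
      = M / T * (a * v ^ 2) + (β - m) / T * (a * v ^ 2) - β / T * (a * v ^ 2) := by ring
  rw [e1, e2]
  linarith

/-- Coercivity of the energy density. -/
lemma le_energy_density {T a S p v ν Λ : ℝ} (ha : 0 < a)
    (hν : 0 < ν) (hΛ : Λ ≤ a * T) (hbig : 2 ≤ ν * Λ) :
    ν * T * S + a / 2 * v ^ 2 ≤ ν * T * (S + p ^ 2) + 2 * v * p + a * v ^ 2 := by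
  have h1 : 2 ≤ ν * (a * T) := hbig.trans (by gcongr)
  have h2 : 0 ≤ (a * v + 2 * p) ^ 2 / (2 * a) := by positivity
  have h3 : (a * v + 2 * p) ^ 2 / (2 * a) = a / 2 * v ^ 2 + 2 * v * p + 2 * p ^ 2 / a := by
    field_simp
    ring
  have h4 : 2 * p ^ 2 / a ≤ ν * T * p ^ 2 := by
    rw [div_le_iff₀ ha]
    nlinarith [sq_nonneg p]
  linarith

section WeightedEnergy

variable {N : ℕ}

/-- The exponential weight `exp (β B(x) / (1 + t))`. -/
noncomputable def expWeight (β : ℝ) (B : EuclideanSpace ℝ (Fin N) → ℝ)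
    (x : EuclideanSpace ℝ (Fin N)) (t : ℝ) : ℝ := Real.exp (β * B x / (1 + t))

/-- The `i`-th partial derivative of a function of the space variable. -/
noncomputable def partialD (i : Fin N) (f : EuclideanSpace ℝ (Fin N) → ℝ)
    (x : EuclideanSpace ℝ (Fin N)) : ℝ := fderiv ℝ f x (EuclideanSpace.single i 1)

/-- The squared length of the spatial gradient. -/
noncomputable def gradSq (V : EuclideanSpace ℝ (Fin N) × ℝ → ℝ)
    (p : EuclideanSpace ℝ (Fin N) × ℝ) : ℝ := ∑ i, spaceD i V p ^ 2

/-- The inner product of the spatial gradients. -/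
noncomputable def gradInner (U V : EuclideanSpace ℝ (Fin N) × ℝ → ℝ)
    (p : EuclideanSpace ℝ (Fin N) × ℝ) : ℝ := ∑ i, spaceD i U p * spaceD i V p

/-- The spatial Laplacian on space-time. -/
noncomputable def spaceLap (V : EuclideanSpace ℝ (Fin N) × ℝ → ℝ)
    (p : EuclideanSpace ℝ (Fin N) × ℝ) : ℝ := ∑ i, spaceD i (spaceD i V) p

/-- The inner product of `∇B / (1 + t)` with the spatial gradient. -/
noncomputable def drift (B : EuclideanSpace ℝ (Fin N) → ℝ)
    (V : EuclideanSpace ℝ (Fin N) × ℝ → ℝ) (p : EuclideanSpace ℝ (Fin N) × ℝ) : ℝ :=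
  ∑ i, partialD i B p.1 / (1 + p.2) * spaceD i V p

/-- The squared length of `∇B / (1 + t)`. -/
noncomputable def driftSq (B : EuclideanSpace ℝ (Fin N) → ℝ)
    (p : EuclideanSpace ℝ (Fin N) × ℝ) : ℝ := ∑ i, (partialD i B p.1 / (1 + p.2)) ^ 2

lemma ContDiff.timeD {V : EuclideanSpace ℝ (Fin N) × ℝ → ℝ} (hV : ContDiff ℝ (⊤ : ℕ∞) V) :
    ContDiff ℝ (⊤ : ℕ∞) (timeD V) := hV.dirDeriv _

lemma ContDiff.spaceD {V : EuclideanSpace ℝ (Fin N) × ℝ → ℝ} (hV : ContDiff ℝ (⊤ : ℕ∞) V)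
    (i : Fin N) : ContDiff ℝ (⊤ : ℕ∞) (spaceD i V) := hV.dirDeriv _

lemma continuous_gradSq {V : EuclideanSpace ℝ (Fin N) × ℝ → ℝ} (hV : ContDiff ℝ (⊤ : ℕ∞) V) :
    Continuous (gradSq V) :=
  continuous_finsetSum _ fun i _ => (hV.spaceD i).continuous.pow 2

lemma continuous_gradInner {U V : EuclideanSpace ℝ (Fin N) × ℝ → ℝ}
    (hU : ContDiff ℝ (⊤ : ℕ∞) U) (hV : ContDiff ℝ (⊤ : ℕ∞) V) : Continuous (gradInner U V) :=
  continuous_finsetSum _ fun i _ => (hU.spaceD i).continuous.mul (hV.spaceD i).continuous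

lemma continuous_spaceLap {V : EuclideanSpace ℝ (Fin N) × ℝ → ℝ} (hV : ContDiff ℝ (⊤ : ℕ∞) V) :
    Continuous (spaceLap V) :=
  continuous_finsetSum _ fun i _ => ((hV.spaceD i).spaceD i).continuous

lemma continuous_partialD {B : EuclideanSpace ℝ (Fin N) → ℝ} (hB : ContDiff ℝ 1 B) (i : Fin N) :
    Continuous (partialD i B) :=
  (hB.continuous_fderiv one_ne_zero).clm_apply continuous_const

lemma contDiff_partialD {B : EuclideanSpace ℝ (Fin N) → ℝ} (hB : ContDiff ℝ 2 B) (i : Fin N) :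
    ContDiff ℝ 1 (partialD i B) :=
  (hB.fderiv_right (m := 1) (by norm_num)).clm_apply contDiff_const

lemma contDiff_expWeight {B : EuclideanSpace ℝ (Fin N) → ℝ} {n : WithTop ℕ∞}
    (hB : ContDiff ℝ n B) (β t : ℝ) : ContDiff ℝ n fun x => expWeight β B x t := by
  unfold expWeight
  exact ((contDiff_const.mul hB).div_const _).exp

lemma continuousOn_expWeight {B : EuclideanSpace ℝ (Fin N) → ℝ} (hB : Continuous B) (β : ℝ) :
    ContinuousOn (fun p : EuclideanSpace ℝ (Fin N) × ℝ => expWeight β B p.1 p.2)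
      (Set.univ ×ˢ Set.Ioi (-1)) := by
  unfold expWeight
  refine Real.continuous_exp.comp_continuousOn (ContinuousOn.div (by fun_prop) (by fun_prop) ?_)
  rintro ⟨x, t⟩ ⟨-, ht⟩
  have : -1 < t := ht
  exact ne_of_gt (by simp only; linarith)

lemma expWeight_pos (β : ℝ) (B : EuclideanSpace ℝ (Fin N) → ℝ) (x : EuclideanSpace ℝ (Fin N))
    (t : ℝ) : 0 < expWeight β B x t := Real.exp_pos _

lemma continuousOn_drift {B : EuclideanSpace ℝ (Fin N) → ℝ} (hB : ContDiff ℝ 1 B)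
    {V : EuclideanSpace ℝ (Fin N) × ℝ → ℝ} (hV : ContDiff ℝ (⊤ : ℕ∞) V) :
    ContinuousOn (drift B V) (Set.univ ×ˢ Set.Ioi (-1)) := by
  refine continuousOn_finsetSum _ fun i _ => ContinuousOn.mul (ContinuousOn.div ?_ (by fun_prop) ?_)
    (hV.spaceD i).continuous.continuousOn
  · exact ((continuous_partialD hB i).comp continuous_fst).continuousOn
  · rintro ⟨x, t⟩ ⟨-, ht⟩
    have : -1 < t := ht
    exact ne_of_gt (by simp only; linarith)

lemma continuousOn_driftSq {B : EuclideanSpace ℝ (Fin N) → ℝ} (hB : ContDiff ℝ 1 B) :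
    ContinuousOn (driftSq B) (Set.univ ×ˢ Set.Ioi (-1)) := by
  refine continuousOn_finsetSum _ fun i _ => (ContinuousOn.div ?_ (by fun_prop) ?_).pow 2
  · exact ((continuous_partialD hB i).comp continuous_fst).continuousOn
  · rintro ⟨x, t⟩ ⟨-, ht⟩
    have : -1 < t := ht
    exact ne_of_gt (by simp only; linarith)

lemma partialD_mul {f g : EuclideanSpace ℝ (Fin N) → ℝ} (i : Fin N)
    {x : EuclideanSpace ℝ (Fin N)} (hf : DifferentiableAt ℝ f x) (hg : DifferentiableAt ℝ g x) :
    partialD i (fun y => f y * g y) x = f x * partialD i g x + partialD i f x * g x := by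
  unfold partialD
  rw [fderiv_fun_mul hf hg]
  simp [mul_comm]

lemma partialD_expWeight {B : EuclideanSpace ℝ (Fin N) → ℝ} (hB : Differentiable ℝ B) (β t : ℝ)
    (i : Fin N) (x : EuclideanSpace ℝ (Fin N)) :
    partialD i (fun y => expWeight β B y t) x
      = expWeight β B x t * (β * (partialD i B x / (1 + t))) := by
  unfold partialD expWeight
  have h1 : HasFDerivAt (fun y => β * B y / (1 + t)) ((β / (1 + t)) • fderiv ℝ B x) x := by
    have := (hB x).hasFDerivAt.const_mul (β / (1 + t))
    refine this.congr_of_eventuallyEq (Eventually.of_forall fun y => ?_)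
    ring
  rw [h1.exp.fderiv]
  simp only [smul_apply, smul_eq_mul]
  ring

lemma contDiff_slice {V : EuclideanSpace ℝ (Fin N) × ℝ → ℝ} {n : WithTop ℕ∞}
    (hV : ContDiff ℝ n V) (t : ℝ) : ContDiff ℝ n fun x => V (x, t) :=
  hV.comp (contDiff_id.prodMk contDiff_const)

lemma hasCompactSupport_of_radius {f : EuclideanSpace ℝ (Fin N) → ℝ} {R : ℝ}
    (h : ∀ x, R < ‖x‖ → f x = 0) : HasCompactSupport f := by
  refine HasCompactSupport.intro (isCompact_closedBall 0 R) fun x hx => h x ?_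
  simpa using hx

lemma setIntegral_sum_partialD {Ω : Set (EuclideanSpace ℝ (Fin N))} (hΩ : IsOpen Ω)
    {f : Fin N → EuclideanSpace ℝ (Fin N) → ℝ} (hf : ∀ i, ContDiff ℝ 1 (f i)) {R : ℝ}
    (hR : ∀ i x, R < ‖x‖ → f i x = 0) (h0 : ∀ i, ∀ x ∈ frontier Ω, f i x = 0) :
    ∫ x in Ω, ∑ i, partialD i (f i) x = 0 := by
  rw [integral_finsetSum]
  · exact Finset.sum_eq_zero fun i _ => setIntegral_fderiv_eq_zero_of_frontier hΩ (hf i)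
      (hasCompactSupport_of_radius (hR i)) (h0 i) _
  · intro i _
    exact (Continuous.integrable_of_hasCompactSupport (continuous_partialD (hf i) i)
      ((hasCompactSupport_of_radius (hR i)).fderiv_apply ℝ _)).integrableOn

/-- Integration by parts for `∇U · ∇V` against the weight. -/
lemma setIntegral_weighted_green {Ω : Set (EuclideanSpace ℝ (Fin N))} (hΩ : IsOpen Ω)
    {B : EuclideanSpace ℝ (Fin N) → ℝ} (hB : ContDiff ℝ 2 B)
    {U V : EuclideanSpace ℝ (Fin N) × ℝ → ℝ}
    (hU : ContDiff ℝ (⊤ : ℕ∞) U) (hV : ContDiff ℝ (⊤ : ℕ∞) V) (β : ℝ) {t R : ℝ}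
    (hR : ∀ x, R < ‖x‖ → U (x, t) = 0) (h0 : ∀ x ∈ frontier Ω, U (x, t) = 0) :
    ∫ x in Ω, expWeight β B x t * (gradInner V U (x, t) + U (x, t) * spaceLap V (x, t)
      + β * U (x, t) * drift B V (x, t)) = 0 := by
  have hB1 : ContDiff ℝ 1 B := hB.of_le (by norm_num)
  have hw := contDiff_expWeight hB1 β t
  have hU1 : ContDiff ℝ 1 fun x => U (x, t) := contDiff_slice (hU.of_le (by exact_mod_cast le_top)) t
  have hV1 : ∀ i, ContDiff ℝ 1 fun x => spaceD i V (x, t) := fun i =>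
    contDiff_slice ((hV.spaceD i).of_le (by exact_mod_cast le_top)) t
  rw [← setIntegral_sum_partialD hΩ
    (f := fun i x => expWeight β B x t * (U (x, t) * spaceD i V (x, t)))
    (fun i => hw.mul (hU1.mul (hV1 i))) (R := R) (fun i x hx => by simp [hR x hx])
    (fun i x hx => by simp [h0 x hx])]
  refine setIntegral_congr_fun hΩ.measurableSet fun x _ => ?_
  simp only [gradInner, spaceLap, drift, Finset.mul_sum, ← Finset.sum_add_distrib]
  refine Finset.sum_congr rfl fun i _ => ?_
  have dU := hU1.differentiable one_ne_zero x
  have dV := (hV1 i).differentiable one_ne_zero x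
  rw [partialD_mul i (hw.differentiable one_ne_zero x) (dU.fun_mul dV), partialD_mul i dU dV,
    partialD_expWeight (hB1.differentiable one_ne_zero)]
  have e1 : partialD i (fun x => U (x, t)) x = spaceD i U (x, t) :=
    fderiv_slice_single hU.differentiable_of_top x t i
  have e2 : partialD i (fun x => spaceD i V (x, t)) x = spaceD i (spaceD i V) (x, t) :=
    fderiv_slice_single (hV.spaceD i).differentiable_of_top x t i
  rw [e1, e2]
  ring

/-- Integration by parts for `div (V² ∇(weight))`. -/
lemma setIntegral_weighted_laplacian {Ω : Set (EuclideanSpace ℝ (Fin N))} (hΩ : IsOpen Ω)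
    {a B : EuclideanSpace ℝ (Fin N) → ℝ} (hB : ContDiff ℝ 2 B) (hlap : ∀ x, lap B x = a x)
    {V : EuclideanSpace ℝ (Fin N) × ℝ → ℝ}
    (hV : ContDiff ℝ (⊤ : ℕ∞) V) (β : ℝ) {t R : ℝ}
    (hR : ∀ x, R < ‖x‖ → V (x, t) = 0) (h0 : ∀ x ∈ frontier Ω, V (x, t) = 0) :
    ∫ x in Ω, expWeight β B x t * ((β * a x / (1 + t) + β ^ 2 * driftSq B (x, t)) * V (x, t) ^ 2
      + 2 * β * V (x, t) * drift B V (x, t)) = 0 := by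
  have hB1 : ContDiff ℝ 1 B := hB.of_le (by norm_num)
  have hw := contDiff_expWeight hB1 β t
  have hV1 : ContDiff ℝ 1 fun x => V (x, t) := contDiff_slice (hV.of_le (by exact_mod_cast le_top)) t
  have hP : ∀ i, ContDiff ℝ 1 fun x => β / (1 + t) * partialD i B x := fun i =>
    contDiff_const.mul (contDiff_partialD hB i)
  rw [← setIntegral_sum_partialD hΩ
    (f := fun i x => expWeight β B x t * ((V (x, t) * V (x, t)) * (β / (1 + t) * partialD i B x)))
    (fun i => hw.mul ((hV1.mul hV1).mul (hP i))) (R := R) (fun i x hx => by simp [hR x hx])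
    (fun i x hx => by simp [h0 x hx])]
  refine setIntegral_congr_fun hΩ.measurableSet fun x _ => ?_
  simp only [driftSq, drift, ← hlap x, lap, Finset.mul_sum, Finset.sum_mul, Finset.sum_div,
    ← Finset.sum_add_distrib]
  refine Finset.sum_congr rfl fun i _ => ?_
  have dV := hV1.differentiable one_ne_zero x
  have dP := (hP i).differentiable one_ne_zero x
  rw [partialD_mul i (hw.differentiable one_ne_zero x) ((dV.fun_mul dV).fun_mul dP),
    partialD_mul i (dV.fun_mul dV) dP, partialD_mul i dV dV,
    partialD_expWeight (hB1.differentiable one_ne_zero),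
    partialD_mul i (differentiableAt_const _)
      ((contDiff_partialD hB i).differentiable one_ne_zero x)]
  have e1 : partialD i (fun x => V (x, t)) x = spaceD i V (x, t) :=
    fderiv_slice_single hV.differentiable_of_top x t i
  have e2 : partialD i (fun _ : EuclideanSpace ℝ (Fin N) => β / (1 + t)) x = 0 := by
    simp [partialD]
  have e3 : fderiv ℝ (fun y => fderiv ℝ B y (EuclideanSpace.single i 1)) x
    (EuclideanSpace.single i 1) = partialD i (partialD i B) x := rfl
  rw [e1, e2, e3]
  ring

end WeightedEnergy

section WeightedEnergy

variable {N : ℕ}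

/-- The unweighted density of the energy functional. -/
noncomputable def energyDensity (a : EuclideanSpace ℝ (Fin N) → ℝ) (ν t₀ : ℝ)
    (V : EuclideanSpace ℝ (Fin N) × ℝ → ℝ) (x : EuclideanSpace ℝ (Fin N)) (t : ℝ) : ℝ :=
  ν * (t₀ + t) * (gradSq V (x, t) + timeD V (x, t) ^ 2) + 2 * V (x, t) * timeD V (x, t)
    + a x * V (x, t) ^ 2

/-- The time derivative of the energy density, divided by the weight. -/
noncomputable def energyDensityDeriv (a B : EuclideanSpace ℝ (Fin N) → ℝ) (β ν t₀ : ℝ)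
    (V : EuclideanSpace ℝ (Fin N) × ℝ → ℝ) (x : EuclideanSpace ℝ (Fin N)) (t : ℝ) : ℝ :=
  -(β * (B x / (1 + t) ^ 2)) * energyDensity a ν t₀ V x t
    + ν * (gradSq V (x, t) + timeD V (x, t) ^ 2)
    + ν * (t₀ + t) * (2 * gradInner V (timeD V) (x, t)
      + 2 * timeD V (x, t) * timeD (timeD V) (x, t))
    + 2 * timeD V (x, t) ^ 2 + 2 * V (x, t) * timeD (timeD V) (x, t)
    + 2 * a x * V (x, t) * timeD V (x, t)

/-- The weighted energy functional. -/
noncomputable def energy (Ω : Set (EuclideanSpace ℝ (Fin N))) (a B : EuclideanSpace ℝ (Fin N) → ℝ)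
    (β ν t₀ : ℝ) (V : EuclideanSpace ℝ (Fin N) × ℝ → ℝ) (t : ℝ) : ℝ :=
  ∫ x in Ω, expWeight β B x t * energyDensity a ν t₀ V x t

/-- The standing assumptions on the coefficients and the parameters of the energy method. -/
structure IsAdmissible (a B : EuclideanSpace ℝ (Fin N) → ℝ) (R₀ β ν η h K Λ t₀ : ℝ) : Prop where
  cont_a : Continuous a
  a_pos : ∀ x, 0 < a x
  smooth_B : ContDiff ℝ 2 B
  B_pos : ∀ x, 0 < B x
  lap_B : ∀ x, lap B x = a x
  grad_B : ∀ x, ∑ i, partialD i B x ^ 2 ≤ h * a x * B x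
  β_pos : 0 < β
  ν_pos : 0 < ν
  η_pos : 0 < η
  η_lt_one : η < 1
  βh : β * h * (1 + η) ≤ (1 - η) ^ 2
  βh' : β * h ≤ 1
  one_le_t₀ : 1 ≤ t₀
  one_le_Λ : 1 ≤ Λ
  two_le : 2 ≤ ν * Λ
  Λ_le : ∀ t ≥ (0 : ℝ), ∀ x, ‖x‖ ≤ R₀ + t → Λ ≤ a x * (t₀ + t)
  B_le : ∀ t ≥ (0 : ℝ), ∀ x, ‖x‖ ≤ R₀ + t → B x / (1 + t) ^ 2 ≤ K * a x

lemma hasDerivAt_expWeight (β : ℝ) (B : EuclideanSpace ℝ (Fin N) → ℝ)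
    (x : EuclideanSpace ℝ (Fin N)) {t : ℝ} (ht : 0 < 1 + t) :
    HasDerivAt (expWeight β B x) (expWeight β B x t * -(β * (B x / (1 + t) ^ 2))) t := by
  have h1 : HasDerivAt (fun s : ℝ => 1 + s) 1 t := (hasDerivAt_id t).const_add 1
  have h2 := ((hasDerivAt_const t (β * B x)).div h1 ht.ne').exp
  refine h2.congr_deriv ?_
  simp only [expWeight, Pi.div_apply]
  ring

lemma hasDerivAt_energyDensity (a B : EuclideanSpace ℝ (Fin N) → ℝ) (β ν t₀ : ℝ)
    {V : EuclideanSpace ℝ (Fin N) × ℝ → ℝ} (hV : ContDiff ℝ (⊤ : ℕ∞) V)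
    (x : EuclideanSpace ℝ (Fin N)) {t : ℝ} (ht : 0 < 1 + t) :
    HasDerivAt (fun s => expWeight β B x s * energyDensity a ν t₀ V x s)
      (expWeight β B x t * energyDensityDeriv a B β ν t₀ V x t) t := by
  have h1 : HasDerivAt (fun s : ℝ => t₀ + s) 1 t := (hasDerivAt_id t).const_add t₀
  have hv := hasDerivAt_timeD hV.differentiable_of_top x t
  have hp := hasDerivAt_timeD hV.timeD.differentiable_of_top x t
  have hS : HasDerivAt (fun s => gradSq V (x, s)) (2 * gradInner V (timeD V) (x, t)) t := by
    have : ∀ i ∈ Finset.univ, HasDerivAt (fun s => spaceD i V (x, s) ^ 2)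
        (2 * (spaceD i V (x, t) * spaceD i (timeD V) (x, t))) t := by
      intro i _
      have h := (hasDerivAt_timeD (hV.spaceD i).differentiable_of_top x t).pow 2
      refine h.congr_deriv ?_
      have : timeD (spaceD i V) = spaceD i (timeD V) := dirDeriv_comm hV _ _
      rw [this]
      simp
      ring
    refine (HasDerivAt.fun_sum this).congr_deriv ?_
    rw [gradInner, Finset.mul_sum]
  have hE := ((((h1.const_mul ν).mul (hS.add (hp.pow 2))).add
    ((hv.const_mul 2).mul hp)).add ((hv.pow 2).const_mul (a x)))
  refine ((hasDerivAt_expWeight β B x ht).mul hE).congr_deriv ?_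
  simp only [energyDensityDeriv, energyDensity, Pi.add_apply, Pi.mul_apply, Pi.pow_apply]
  push_cast
  ring

variable {Ω : Set (EuclideanSpace ℝ (Fin N))} {a B : EuclideanSpace ℝ (Fin N) → ℝ}
  {R₀ β ν η h K Λ t₀ : ℝ} {V : EuclideanSpace ℝ (Fin N) × ℝ → ℝ}

lemma IsDampedWave.gradSq_eq_zero (hV : IsDampedWave Ω a R₀ V) {s : ℝ} (hs : 0 ≤ s)
    {x : EuclideanSpace ℝ (Fin N)} (hx : R₀ + s < ‖x‖) : gradSq V (x, s) = 0 := by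
  simp [gradSq, hV.supp_spaceD _ s hs x hx]

lemma IsDampedWave.gradInner_eq_zero (hV : IsDampedWave Ω a R₀ V)
    (U : EuclideanSpace ℝ (Fin N) × ℝ → ℝ) {s : ℝ} (hs : 0 ≤ s)
    {x : EuclideanSpace ℝ (Fin N)} (hx : R₀ + s < ‖x‖) : gradInner V U (x, s) = 0 := by
  simp [gradInner, hV.supp_spaceD _ s hs x hx]

lemma IsDampedWave.energyDensity_eq_zero (hV : IsDampedWave Ω a R₀ V) {s : ℝ} (hs : 0 ≤ s)
    {x : EuclideanSpace ℝ (Fin N)} (hx : R₀ + s < ‖x‖) : energyDensity a ν t₀ V x s = 0 := by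
  simp [energyDensity, hV.gradSq_eq_zero hs hx, hV.supp s hs x hx, hV.supp_timeD s hs x hx]

lemma IsDampedWave.energyDensityDeriv_eq_zero (hV : IsDampedWave Ω a R₀ V) {s : ℝ} (hs : 0 ≤ s)
    {x : EuclideanSpace ℝ (Fin N)} (hx : R₀ + s < ‖x‖) :
    energyDensityDeriv a B β ν t₀ V x s = 0 := by
  simp [energyDensityDeriv, hV.energyDensity_eq_zero hs hx, hV.gradSq_eq_zero hs hx,
    hV.gradInner_eq_zero _ hs hx, hV.supp s hs x hx, hV.supp_timeD s hs x hx]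

lemma continuous_energyDensity (ha : Continuous a) (hV : ContDiff ℝ (⊤ : ℕ∞) V) :
    Continuous fun p : EuclideanSpace ℝ (Fin N) × ℝ => energyDensity a ν t₀ V p.1 p.2 := by
  have c1 := hV.continuous
  have c2 := hV.timeD.continuous
  have c3 := continuous_gradSq hV
  unfold energyDensity
  fun_prop

lemma continuousOn_energyDensityDeriv (ha : Continuous a) (hB : Continuous B)
    (hV : ContDiff ℝ (⊤ : ℕ∞) V) :
    ContinuousOn (fun p : EuclideanSpace ℝ (Fin N) × ℝ => energyDensityDeriv a B β ν t₀ V p.1 p.2)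
      (Set.univ ×ˢ Set.Ioi (-1)) := by
  have c1 := hV.continuous
  have c2 := hV.timeD.continuous
  have c3 := continuous_gradSq hV
  have c4 := continuous_gradInner hV hV.timeD
  have c5 := hV.timeD.timeD.continuous
  have c6 := continuous_energyDensity (ν := ν) (t₀ := t₀) ha hV
  have c7 : ContinuousOn (fun p : EuclideanSpace ℝ (Fin N) × ℝ => B p.1 / (1 + p.2) ^ 2)
      (Set.univ ×ˢ Set.Ioi (-1)) := by
    refine ContinuousOn.div (by fun_prop) (by fun_prop) ?_
    rintro ⟨x, t⟩ ⟨-, ht⟩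
    have : -1 < t := ht
    exact ne_of_gt (pow_pos (by simp only; linarith) 2)
  unfold energyDensityDeriv
  fun_prop

lemma continuousOn_energy (ha : Continuous a) (hB : Continuous B) (hV : IsDampedWave Ω a R₀ V) :
    ContinuousOn (energy Ω a B β ν t₀ V) (Set.Ici 0) :=
  continuousOn_setIntegral_of_finite_propagation (R₀ := R₀)
    (F := fun x t => expWeight β B x t * energyDensity a ν t₀ V x t)
    ((continuousOn_expWeight hB β).mul (continuous_energyDensity ha hV.smooth).continuousOn)
    (fun s hs x hx => by rw [hV.energyDensity_eq_zero hs hx, mul_zero]) Ω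

lemma hasDerivAt_energy (ha : Continuous a) (hB : Continuous B) (hV : IsDampedWave Ω a R₀ V)
    {t : ℝ} (ht : 0 < t) :
    HasDerivAt (energy Ω a B β ν t₀ V)
      (∫ x in Ω, expWeight β B x t * energyDensityDeriv a B β ν t₀ V x t) t :=
  hasDerivAt_setIntegral_of_finite_propagation (R₀ := R₀)
    (F := fun x t => expWeight β B x t * energyDensity a ν t₀ V x t)
    (F' := fun x t => expWeight β B x t * energyDensityDeriv a B β ν t₀ V x t)
    ((continuousOn_expWeight hB β).mul (continuous_energyDensity ha hV.smooth).continuousOn)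
    ((continuousOn_expWeight hB β).mul (continuousOn_energyDensityDeriv ha hB hV.smooth))
    (fun s hs x hx => by rw [hV.energyDensity_eq_zero hs hx, mul_zero])
    (fun s hs x hx => by rw [hV.energyDensityDeriv_eq_zero hs hx, mul_zero])
    (fun x s hs => hasDerivAt_energyDensity a B β ν t₀ hV.smooth x (by linarith)) Ω ht

/-- The weighted square integral `∫ Φ a V²`. -/
noncomputable def weightedSq (Ω : Set (EuclideanSpace ℝ (Fin N)))
    (a B : EuclideanSpace ℝ (Fin N) → ℝ) (β : ℝ)
    (V : EuclideanSpace ℝ (Fin N) × ℝ → ℝ) (t : ℝ) : ℝ :=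
  ∫ x in Ω, expWeight β B x t * (a x * V (x, t) ^ 2)

/-- The weighted Dirichlet integral `∫ Φ |∇V|²`. -/
noncomputable def weightedGradSq (Ω : Set (EuclideanSpace ℝ (Fin N)))
    (B : EuclideanSpace ℝ (Fin N) → ℝ) (β : ℝ)
    (V : EuclideanSpace ℝ (Fin N) × ℝ → ℝ) (t : ℝ) : ℝ :=
  ∫ x in Ω, expWeight β B x t * gradSq V (x, t)

lemma integrable_weighted (hB : Continuous B) {f : EuclideanSpace ℝ (Fin N) → ℝ → ℝ}
    (hf : ContinuousOn (fun p : EuclideanSpace ℝ (Fin N) × ℝ => f p.1 p.2)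
      (Set.univ ×ˢ Set.Ioi (-1)))
    (hsupp : ∀ s ≥ (0 : ℝ), ∀ x, R₀ + s < ‖x‖ → f x s = 0) {t : ℝ} (ht : 0 ≤ t) :
    IntegrableOn (fun x => expWeight β B x t * f x t) Ω :=
  (integrable_slice_of_finite_propagation (F := fun x t => expWeight β B x t * f x t) (R₀ := R₀)
    ((continuousOn_expWeight hB β).mul hf)
    (fun s hs x hx => by rw [hsupp s hs x hx, mul_zero]) ht).integrableOn

/-- Integration of a pointwise linear inequality between integrable functions. -/
lemma setIntegral_linear_le {f₁ f₂ f₃ f₄ f₅ f₆ f₇ : EuclideanSpace ℝ (Fin N) → ℝ}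
    {c₁ c₃ c₄ c₆ c₇ : ℝ} (hΩ : MeasurableSet Ω) (i₁ : IntegrableOn f₁ Ω) (i₂ : IntegrableOn f₂ Ω)
    (i₃ : IntegrableOn f₃ Ω) (i₄ : IntegrableOn f₄ Ω) (i₅ : IntegrableOn f₅ Ω)
    (i₆ : IntegrableOn f₆ Ω) (i₇ : IntegrableOn f₇ Ω)
    (hle : ∀ x ∈ Ω, c₁ * f₁ x + f₂ x - c₃ * f₃ x - c₄ * f₄ x - f₅ x ≤ c₆ * f₆ x - c₇ * f₇ x) :
    c₁ * (∫ x in Ω, f₁ x) + (∫ x in Ω, f₂ x) - c₃ * (∫ x in Ω, f₃ x) - c₄ * (∫ x in Ω, f₄ x)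
      - (∫ x in Ω, f₅ x) ≤ c₆ * (∫ x in Ω, f₆ x) - c₇ * (∫ x in Ω, f₇ x) := by
  have j₁ : IntegrableOn (fun x => c₁ * f₁ x + f₂ x) Ω := (i₁.const_mul c₁).add i₂
  have j₂ : IntegrableOn (fun x => c₁ * f₁ x + f₂ x - c₃ * f₃ x) Ω := j₁.sub (i₃.const_mul c₃)
  have j₃ : IntegrableOn (fun x => c₁ * f₁ x + f₂ x - c₃ * f₃ x - c₄ * f₄ x) Ω :=
    j₂.sub (i₄.const_mul c₄)
  have hmono := setIntegral_mono_on (f := fun x => c₁ * f₁ x + f₂ x - c₃ * f₃ x - c₄ * f₄ x - f₅ x)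
    (g := fun x => c₆ * f₆ x - c₇ * f₇ x) (s := Ω) (μ := volume) (j₃.sub i₅)
    ((i₆.const_mul c₆).sub (i₇.const_mul c₇)) hΩ hle
  rw [integral_sub j₃ i₅, integral_sub j₂ (i₄.const_mul c₄), integral_sub j₁ (i₃.const_mul c₃),
    integral_add (i₁.const_mul c₁) i₂, integral_sub (i₆.const_mul c₆) (i₇.const_mul c₇)] at hmono
  simpa only [integral_const_mul] using hmono

/-- The differential inequality for the weighted energy. -/
lemma energy_deriv_le (hΩ : IsOpen Ω) (H : IsAdmissible a B R₀ β ν η h K Λ t₀)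
    (hV : IsDampedWave Ω a R₀ V) {M m t : ℝ} (hm : m < β) (ht : 0 < t)
    (hνM : (M + 1) * ν ≤ 2 * η)
    (hbig : (M + 1) * ν + β * K / η + M ^ 2 / (β - m) + 2 ≤ ν / 2 * Λ) :
    M / (t₀ + t) * energy Ω a B β ν t₀ V t
      + ∫ x in Ω, expWeight β B x t * energyDensityDeriv a B β ν t₀ V x t
    ≤ (M - m) / (t₀ + t) * weightedSq Ω a B β V t
      - ν / 2 * (t₀ + t) * weightedSq Ω a B β (timeD V) t := by
  have hB := H.smooth_B.continuous
  have hB1 : ContDiff ℝ 1 B := H.smooth_B.of_le (by norm_num)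
  have ha := H.cont_a
  have hsm := hV.smooth
  have ht0 := ht.le
  have c0 := ha.comp (continuous_fst (X := EuclideanSpace ℝ (Fin N)) (Y := ℝ))
  have c1 := hsm.continuous
  have c2 := hsm.timeD.continuous
  have c3 := continuous_gradSq hsm
  have c4 := continuous_gradInner hsm hsm.timeD
  have c5 := continuous_spaceLap hsm
  have c6 := continuousOn_drift hB1 hsm
  have c7 := continuousOn_driftSq hB1
  have cE := continuous_energyDensity (ν := ν) (t₀ := t₀) ha hsm
  have i1 : IntegrableOn (fun x => expWeight β B x t * energyDensity a ν t₀ V x t) Ω :=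
    integrable_weighted (R₀ := R₀) hB cE.continuousOn
      (fun s hs x hx => hV.energyDensity_eq_zero hs hx) ht0
  have i2 : IntegrableOn (fun x => expWeight β B x t * energyDensityDeriv a B β ν t₀ V x t) Ω :=
    integrable_weighted (R₀ := R₀) hB (continuousOn_energyDensityDeriv ha hB hsm)
      (fun s hs x hx => hV.energyDensityDeriv_eq_zero hs hx) ht0
  have i3 : IntegrableOn (fun x => expWeight β B x t * (gradInner V (timeD V) (x, t)
      + timeD V (x, t) * spaceLap V (x, t) + β * timeD V (x, t) * drift B V (x, t))) Ω := by
    refine integrable_weighted (R₀ := R₀) hB (f := fun x t => gradInner V (timeD V) (x, t)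
      + timeD V (x, t) * spaceLap V (x, t) + β * timeD V (x, t) * drift B V (x, t)) ?_ ?_ ht0
    · simp only [Prod.mk.eta]
      fun_prop
    · intro s hs x hx
      simp [hV.gradInner_eq_zero _ hs hx, hV.supp_timeD s hs x hx]
  have i4 : IntegrableOn (fun x => expWeight β B x t * (gradInner V V (x, t)
      + V (x, t) * spaceLap V (x, t) + β * V (x, t) * drift B V (x, t))) Ω := by
    refine integrable_weighted (R₀ := R₀) hB (f := fun x t => gradInner V V (x, t)
      + V (x, t) * spaceLap V (x, t) + β * V (x, t) * drift B V (x, t)) ?_ ?_ ht0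
    · have c4' := continuous_gradInner hsm hsm
      simp only [Prod.mk.eta]
      fun_prop
    · intro s hs x hx
      simp [hV.gradInner_eq_zero _ hs hx, hV.supp s hs x hx]
  have i5 : IntegrableOn (fun x => expWeight β B x t * ((β * a x / (1 + t)
      + β ^ 2 * driftSq B (x, t)) * V (x, t) ^ 2 + 2 * β * V (x, t) * drift B V (x, t))) Ω := by
    refine integrable_weighted (R₀ := R₀) hB (f := fun x t => (β * a x / (1 + t)
      + β ^ 2 * driftSq B (x, t)) * V (x, t) ^ 2 + 2 * β * V (x, t) * drift B V (x, t)) ?_ ?_ ht0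
    · have c8 : ContinuousOn (fun p : EuclideanSpace ℝ (Fin N) × ℝ => β * a p.1 / (1 + p.2))
          (Set.univ ×ˢ Set.Ioi (-1)) := by
        refine ContinuousOn.div (by fun_prop) (by fun_prop) ?_
        rintro ⟨x, t⟩ ⟨-, ht⟩
        have : -1 < t := ht
        exact ne_of_gt (by simp only; linarith)
      simp only [Prod.mk.eta]
      fun_prop
    · intro s hs x hx
      simp [hV.supp s hs x hx]
  have i6 : IntegrableOn (fun x => expWeight β B x t * (a x * V (x, t) ^ 2)) Ω := by
    refine integrable_weighted (R₀ := R₀) hB (f := fun x t => a x * V (x, t) ^ 2) ?_ ?_ ht0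
    · simp only [Prod.mk.eta]
      fun_prop
    · intro s hs x hx
      simp [hV.supp s hs x hx]
  have i7 : IntegrableOn (fun x => expWeight β B x t * (a x * timeD V (x, t) ^ 2)) Ω := by
    refine integrable_weighted (R₀ := R₀) hB (f := fun x t => a x * timeD V (x, t) ^ 2) ?_ ?_ ht0
    · simp only [Prod.mk.eta]
      fun_prop
    · intro s hs x hx
      simp [hV.supp_timeD s hs x hx]
  have z3 := setIntegral_weighted_green hΩ H.smooth_B hsm.timeD hsm β (t := t) (R := R₀ + t)
    (hV.supp_timeD t ht0) (fun x hx => hV.time_deriv.bdry x hx t ht)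
  have z4 := setIntegral_weighted_green hΩ H.smooth_B hsm hsm β (t := t) (R := R₀ + t)
    (hV.supp t ht0) (fun x hx => hV.bdry x hx t ht)
  have z5 := setIntegral_weighted_laplacian hΩ H.smooth_B H.lap_B hsm β (t := t) (R := R₀ + t)
    (hV.supp t ht0) (fun x hx => hV.bdry x hx t ht)
  have hmono := setIntegral_linear_le (c₁ := M / (t₀ + t)) (c₃ := 2 * ν * (t₀ + t)) (c₄ := 2)
    (c₆ := (M - m) / (t₀ + t)) (c₇ := ν / 2 * (t₀ + t)) hΩ.measurableSet i1 i2 i3 i4 i5 i6 i7 ?_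
  · rw [z3, z4, z5] at hmono
    unfold energy weightedSq
    linarith
  · intro x hx
    have hw := expWeight_pos β B x t
    by_cases hxR : ‖x‖ ≤ R₀ + t
    · have hpt := energy_density_le (T := t₀ + t) (τ := 1 + t) (σ := B x / (1 + t) ^ 2)
        (a := a x) (S := gradSq V (x, t)) (p := timeD V (x, t)) (v := V (x, t))
        (X := drift B V (x, t)) (G := driftSq B (x, t)) (W := gradInner V (timeD V) (x, t))
        (L := spaceLap V (x, t)) (β := β) (ν := ν) (η := η) (h := h) (K := K) (Λ := Λ) (M := M)
        (m := m) (by linarith) (by linarith [H.one_le_t₀])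
        (div_pos (H.B_pos x) (by positivity)) (H.a_pos x) H.β_pos H.ν_pos H.η_pos H.η_lt_one
        (Finset.sum_nonneg fun i _ => sq_nonneg _) hm ?_ ?_ (H.B_le t ht0 x hxR) H.one_le_Λ
        (H.Λ_le t ht0 x hxR) H.βh H.βh' hνM hbig
      · have hq : timeD (timeD V) (x, t) = spaceLap V (x, t) - a x * timeD V (x, t) :=
          hV.eqn_of_nonneg hx ht0
        have hg : gradInner V V (x, t) = gradSq V (x, t) := by
          simp [gradInner, gradSq, sq]
        have := mul_le_mul_of_nonneg_left hpt hw.le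
        simp only [energyDensityDeriv, energyDensity, hq, hg]
        linarith
      · intro r s
        have : r ^ 2 * gradSq V (x, t) + 2 * r * s * drift B V (x, t) + s ^ 2 * driftSq B (x, t)
            = ∑ i, (r * spaceD i V (x, t) + s * (partialD i B x / (1 + t))) ^ 2 := by
          simp only [gradSq, drift, driftSq, Finset.mul_sum, ← Finset.sum_add_distrib]
          exact Finset.sum_congr rfl fun i _ => by ring
        rw [this]
        exact Finset.sum_nonneg fun i _ => sq_nonneg _
      · have : driftSq B (x, t) = (∑ i, partialD i B x ^ 2) / (1 + t) ^ 2 := by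
          simp only [driftSq, Finset.sum_div, div_pow]
        rw [this, ← mul_div_assoc]
        gcongr
        exact H.grad_B x
    · have hx' := not_le.1 hxR
      refine le_of_eq ?_
      simp [hV.energyDensity_eq_zero ht0 hx', hV.energyDensityDeriv_eq_zero ht0 hx',
        hV.gradInner_eq_zero _ ht0 hx', hV.supp t ht0 x hx', hV.supp_timeD t ht0 x hx']

/-- Coercivity of the weighted energy. -/
lemma le_energy (hΩ : IsOpen Ω) (H : IsAdmissible a B R₀ β ν η h K Λ t₀)
    (hV : IsDampedWave Ω a R₀ V) {t : ℝ} (ht : 0 ≤ t) :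
    ν * (t₀ + t) * weightedGradSq Ω B β V t + 1 / 2 * weightedSq Ω a B β V t
      ≤ energy Ω a B β ν t₀ V t := by
  have hB := H.smooth_B.continuous
  have ha := H.cont_a
  have c1 := hV.smooth.continuous
  have c3 := continuous_gradSq hV.smooth
  have cE := continuous_energyDensity (ν := ν) (t₀ := t₀) ha hV.smooth
  have i1 : IntegrableOn (fun x => expWeight β B x t * energyDensity a ν t₀ V x t) Ω :=
    integrable_weighted (R₀ := R₀) hB cE.continuousOn
      (fun s hs x hx => hV.energyDensity_eq_zero hs hx) ht
  have i6 : IntegrableOn (fun x => expWeight β B x t * (a x * V (x, t) ^ 2)) Ω := by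
    refine integrable_weighted (R₀ := R₀) hB (f := fun x t => a x * V (x, t) ^ 2) ?_ ?_ ht
    · simp only [Prod.mk.eta]
      fun_prop
    · intro s hs x hx
      simp [hV.supp s hs x hx]
  have i7 : IntegrableOn (fun x => expWeight β B x t * gradSq V (x, t)) Ω :=
    integrable_weighted (R₀ := R₀) hB (f := fun x t => gradSq V (x, t)) c3.continuousOn
      (fun s hs x hx => hV.gradSq_eq_zero hs hx) ht
  unfold weightedGradSq weightedSq energy
  rw [← integral_const_mul, ← integral_const_mul,
    ← integral_add (i7.const_mul _) (i6.const_mul _)]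
  refine setIntegral_mono_on ((i7.const_mul _).add (i6.const_mul _)) i1 hΩ.measurableSet
    fun x _ => ?_
  have hw := expWeight_pos β B x t
  by_cases hxR : ‖x‖ ≤ R₀ + t
  · have := mul_le_mul_of_nonneg_left (le_energy_density (S := gradSq V (x, t))
      (p := timeD V (x, t)) (v := V (x, t)) (H.a_pos x) H.ν_pos (H.Λ_le t ht x hxR) H.two_le) hw.le
    unfold energyDensity
    linarith
  · have hx' := not_le.1 hxR
    simp [hV.energyDensity_eq_zero ht hx', hV.gradSq_eq_zero ht hx', hV.supp t ht x hx']

lemma weightedSq_nonneg (ha : ∀ x, 0 < a x) (t : ℝ) : 0 ≤ weightedSq Ω a B β V t :=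
  integral_nonneg fun x => mul_nonneg (expWeight_pos β B x t).le
    (mul_nonneg (ha x).le (sq_nonneg _))

lemma weightedGradSq_nonneg (t : ℝ) : 0 ≤ weightedGradSq Ω B β V t :=
  integral_nonneg fun x => mul_nonneg (expWeight_pos β B x t).le
    (Finset.sum_nonneg fun _ _ => sq_nonneg _)

end WeightedEnergy

section Decay

variable {N : ℕ} {Ω : Set (EuclideanSpace ℝ (Fin N))} {a B : EuclideanSpace ℝ (Fin N) → ℝ}
  {R₀ β ν η h K Λ t₀ : ℝ} {V : EuclideanSpace ℝ (Fin N) × ℝ → ℝ}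

lemma sum_telescoping_le {I : ℕ → ℝ} (hI : ∀ j, 0 ≤ I j) {θ : ℝ} (hθ : 0 ≤ θ) {n : ℕ}
    (hn : 2 * (n : ℝ) * θ ≤ ν / 2) :
    ∑ j ∈ Finset.range (n + 1), θ ^ j * (2 * (j : ℝ) * I j - ν / 2 * I (j + 1))
      ≤ -(ν / 2) * θ ^ n * I (n + 1) := by
  induction n with
  | zero => simp
  | succ n ih =>
    rw [Finset.sum_range_succ]
    push_cast at hn ⊢
    have h1 := ih (by nlinarith)
    have h2 := mul_le_mul_of_nonneg_right hn (mul_nonneg (pow_nonneg hθ n) (hI (n + 1)))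
    rw [pow_succ]
    nlinarith

/-- The sum of the weighted energies of the first time derivatives. -/
noncomputable def lyapunov (Ω : Set (EuclideanSpace ℝ (Fin N)))
    (a B : EuclideanSpace ℝ (Fin N) → ℝ) (β ν t₀ m θ : ℝ) (k : ℕ)
    (V : EuclideanSpace ℝ (Fin N) × ℝ → ℝ) (t : ℝ) : ℝ :=
  ∑ j ∈ Finset.range (k + 1),
    θ ^ j * ((t₀ + t) ^ (m + 2 * (j : ℝ)) * energy Ω a B β ν t₀ (timeD^[j] V) t)

lemma energy_nonneg (hΩ : IsOpen Ω) (H : IsAdmissible a B R₀ β ν η h K Λ t₀)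
    (hV : IsDampedWave Ω a R₀ V) {t : ℝ} (ht : 0 ≤ t) : 0 ≤ energy Ω a B β ν t₀ V t := by
  have h1 := le_energy hΩ H hV ht
  have h2 := weightedSq_nonneg (Ω := Ω) (B := B) (β := β) (V := V) H.a_pos t
  have h3 := mul_nonneg (mul_nonneg H.ν_pos.le (by linarith [H.one_le_t₀] : 0 ≤ t₀ + t))
    (weightedGradSq_nonneg (Ω := Ω) (B := B) (β := β) (V := V) t)
  linarith

lemma lyapunov_le (hΩ : IsOpen Ω) (H : IsAdmissible a B R₀ β ν η h K Λ t₀)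
    (hV : IsDampedWave Ω a R₀ V) {m θ : ℝ} {k : ℕ} (hm0 : 0 < m) (hm : m < β) (hθ : 0 ≤ θ)
    (hθk : 2 * (k : ℝ) * θ ≤ ν / 2) (hνM : (m + 2 * k + 1) * ν ≤ 2 * η)
    (hbig : (m + 2 * k + 1) * ν + β * K / η + (m + 2 * k) ^ 2 / (β - m) + 2 ≤ ν / 2 * Λ)
    {t : ℝ} (ht : 0 ≤ t) :
    lyapunov Ω a B β ν t₀ m θ k V t ≤ lyapunov Ω a B β ν t₀ m θ k V 0 := by
  have hB := H.smooth_B.continuous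
  have hVj := fun j => hV.iterate_timeD j
  have hanti : AntitoneOn (lyapunov Ω a B β ν t₀ m θ k V) (Set.Ici 0) := by
    have hd : ∀ s > (0 : ℝ), HasDerivAt (lyapunov Ω a B β ν t₀ m θ k V)
        (∑ j ∈ Finset.range (k + 1), θ ^ j * ((m + 2 * (j : ℝ)) * (t₀ + s) ^ (m + 2 * (j : ℝ) - 1)
          * energy Ω a B β ν t₀ (timeD^[j] V) s + (t₀ + s) ^ (m + 2 * (j : ℝ))
          * ∫ x in Ω, expWeight β B x s * energyDensityDeriv a B β ν t₀ (timeD^[j] V) x s)) s := by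
      intro s hs
      refine HasDerivAt.fun_sum fun j _ => HasDerivAt.const_mul _ (HasDerivAt.mul ?_
        (hasDerivAt_energy H.cont_a hB (hVj j) hs))
      have h1 : HasDerivAt (fun s : ℝ => t₀ + s) 1 s := (hasDerivAt_id s).const_add t₀
      have h2 := h1.rpow_const (p := m + 2 * (j : ℝ))
        (Or.inl (by linarith [H.one_le_t₀]))
      exact h2.congr_deriv (by ring)
    refine antitoneOn_of_hasDerivWithinAt_nonpos (convex_Ici 0) ?_ (fun s hs => ?_) (fun s hs => ?_)
      (f' := fun s => ∑ j ∈ Finset.range (k + 1), θ ^ j * ((m + 2 * (j : ℝ))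
          * (t₀ + s) ^ (m + 2 * (j : ℝ) - 1)
          * energy Ω a B β ν t₀ (timeD^[j] V) s + (t₀ + s) ^ (m + 2 * (j : ℝ))
          * ∫ x in Ω, expWeight β B x s * energyDensityDeriv a B β ν t₀ (timeD^[j] V) x s))
    · refine continuousOn_finsetSum _ fun j _ => continuousOn_const.mul (ContinuousOn.mul ?_
        (continuousOn_energy H.cont_a hB (hVj j)))
      refine ContinuousOn.rpow_const (by fun_prop) fun s hs => Or.inl ?_
      have : (0 : ℝ) ≤ s := hs
      linarith [H.one_le_t₀]
    · rw [interior_Ici] at hs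
      exact (hd s hs).hasDerivWithinAt
    · rw [interior_Ici] at hs
      have hs' : (0 : ℝ) < s := hs
      have hT : 0 < t₀ + s := by linarith [H.one_le_t₀]
      set I : ℕ → ℝ := fun j => (t₀ + s) ^ (m + 2 * (j : ℝ)) / (t₀ + s)
        * weightedSq Ω a B β (timeD^[j] V) s with hI
      have hI0 : ∀ j, 0 ≤ I j := fun j =>
        mul_nonneg (by positivity) (weightedSq_nonneg H.a_pos s)
      refine (Finset.sum_le_sum fun j hj => ?_).trans ((sum_telescoping_le hI0 hθ hθk).trans ?_)
      · refine mul_le_mul_of_nonneg_left ?_ (pow_nonneg hθ j)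
        have hjk : (j : ℝ) ≤ k := by
          exact_mod_cast Nat.lt_succ_iff.1 (Finset.mem_range.1 hj)
        have hj0 : (0 : ℝ) ≤ j := Nat.cast_nonneg j
        have hν := H.ν_pos
        have hβm : 0 < β - m := by linarith
        have hM1 : (m + 2 * (j : ℝ) + 1) * ν ≤ (m + 2 * k + 1) * ν := by gcongr
        have hM2 : (m + 2 * (j : ℝ)) ^ 2 / (β - m) ≤ (m + 2 * k) ^ 2 / (β - m) := by gcongr
        have key := energy_deriv_le hΩ H (hVj j) (M := m + 2 * (j : ℝ)) hm hs'
          (by linarith) (by linarith)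
        have hP : 0 < (t₀ + s) ^ (m + 2 * (j : ℝ)) := by positivity
        have hkey := mul_le_mul_of_nonneg_left key hP.le
        have e1 : (t₀ + s) ^ (m + 2 * (j : ℝ) - 1) = (t₀ + s) ^ (m + 2 * (j : ℝ)) / (t₀ + s) :=
          Real.rpow_sub_one hT.ne' _
        have e2 : (t₀ + s) ^ (m + 2 * ((j + 1 : ℕ) : ℝ))
            = (t₀ + s) ^ (m + 2 * (j : ℝ)) * (t₀ + s) ^ 2 := by
          rw [← Real.rpow_natCast, ← Real.rpow_add hT]
          congr 1
          push_cast
          ring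
        simp only [hI]
        rw [e2, Function.iterate_succ_apply', e1]
        refine le_of_eq_of_le ?_ (hkey.trans_eq ?_)
        · field_simp
        · field_simp
          ring
      · have := mul_nonneg (mul_nonneg H.ν_pos.le (pow_nonneg hθ k)) (hI0 (k + 1))
        linarith
  exact hanti Set.self_mem_Ici ht ht

/-- Weighted decay of all time derivatives in terms of the initial energies. -/
lemma energy_decay (hΩ : IsOpen Ω) (H : IsAdmissible a B R₀ β ν η h K Λ t₀)
    (hV : IsDampedWave Ω a R₀ V) {m θ : ℝ} {k : ℕ} (hm0 : 0 < m) (hm : m < β) (hθ : 0 < θ)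
    (hθk : 2 * (k : ℝ) * θ ≤ ν / 2) (hνM : (m + 2 * k + 1) * ν ≤ 2 * η)
    (hbig : (m + 2 * k + 1) * ν + β * K / η + (m + 2 * k) ^ 2 / (β - m) + 2 ≤ ν / 2 * Λ)
    {t : ℝ} (ht : 0 ≤ t) :
    energy Ω a B β ν t₀ (timeD^[k] V) t
      ≤ lyapunov Ω a B β ν t₀ m θ k V 0 / θ ^ k * (t₀ + t) ^ (-(m + 2 * (k : ℝ))) := by
  have hT : 0 < t₀ + t := by linarith [H.one_le_t₀]
  have h1 := lyapunov_le hΩ H hV hm0 hm hθ.le hθk hνM hbig ht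
  have h2 : θ ^ k * ((t₀ + t) ^ (m + 2 * (k : ℝ)) * energy Ω a B β ν t₀ (timeD^[k] V) t)
      ≤ lyapunov Ω a B β ν t₀ m θ k V t :=
    Finset.single_le_sum (f := fun j : ℕ => θ ^ j * ((t₀ + t) ^ (m + 2 * (j : ℝ))
      * energy Ω a B β ν t₀ (timeD^[j] V) t))
      (fun j _ => mul_nonneg (pow_nonneg hθ.le j) (mul_nonneg (by positivity)
        (energy_nonneg hΩ H (hV.iterate_timeD j) ht))) (Finset.self_mem_range_succ k)
  rw [Real.rpow_neg hT.le, ← div_eq_mul_inv, div_div, le_div_iff₀ (by positivity)]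
  linarith

end Decay

section InitialData

variable {N : ℕ} {Ω : Set (EuclideanSpace ℝ (Fin N))} {a B : EuclideanSpace ℝ (Fin N) → ℝ}
  {R₀ β ν t₀ : ℝ}

lemma norm_iteratedFDeriv_spaceD_slice_le {V : EuclideanSpace ℝ (Fin N) × ℝ → ℝ}
    (hV : ContDiff ℝ (⊤ : ℕ∞) V) (i : Fin N) (s : ℝ) (p : ℕ) (x : EuclideanSpace ℝ (Fin N)) :
    ‖iteratedFDeriv ℝ p (fun y => spaceD i V (y, s)) x‖
      ≤ ‖iteratedFDeriv ℝ (p + 1) (fun y => V (y, s)) x‖ := by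
  have h1 : (fun y => spaceD i V (y, s))
      = fun y => fderiv ℝ (fun z => V (z, s)) y (EuclideanSpace.single i 1) :=
    funext fun y => (fderiv_slice_single hV.differentiable_of_top y s i).symm
  have h2 : ContDiff ℝ p (fderiv ℝ fun z => V (z, s)) :=
    (contDiff_slice hV s).fderiv_right (by exact_mod_cast le_top)
  rw [h1, ← norm_iteratedFDeriv_fderiv]
  refine (norm_iteratedFDeriv_clm_apply_const h2.contDiffAt le_rfl).trans ?_
  simp

lemma norm_iteratedFDeriv_spaceLap_slice_le {V : EuclideanSpace ℝ (Fin N) × ℝ → ℝ}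
    (hV : ContDiff ℝ (⊤ : ℕ∞) V) (s : ℝ) (p : ℕ) (x : EuclideanSpace ℝ (Fin N)) :
    ‖iteratedFDeriv ℝ p (fun y => spaceLap V (y, s)) x‖
      ≤ N * ‖iteratedFDeriv ℝ (p + 2) (fun y => V (y, s)) x‖ := by
  unfold spaceLap
  rw [iteratedFDeriv_sum fun i _ => (contDiff_slice ((hV.spaceD i).spaceD i) s).of_le
    (by exact_mod_cast le_top), Finset.sum_apply]
  refine (norm_sum_le_of_le _ fun i _ => (norm_iteratedFDeriv_spaceD_slice_le (hV.spaceD i) i s p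
    x).trans (norm_iteratedFDeriv_spaceD_slice_le hV i s (p + 1) x)).trans_eq ?_
  simp

/-- The sum of the norms of the derivatives of the initial data. -/
noncomputable def dataNorm (k : ℕ) (V : EuclideanSpace ℝ (Fin N) × ℝ → ℝ)
    (x : EuclideanSpace ℝ (Fin N)) : ℝ :=
  ∑ j ∈ Finset.range (k + 2), ‖iteratedFDeriv ℝ j (fun y => V (y, 0)) x‖
    + ∑ j ∈ Finset.range (k + 1), ‖iteratedFDeriv ℝ j (fun y => timeD V (y, 0)) x‖

/-- The sum of the squared norms of the derivatives of the initial data. -/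
noncomputable def dataSq (k : ℕ) (V : EuclideanSpace ℝ (Fin N) × ℝ → ℝ)
    (x : EuclideanSpace ℝ (Fin N)) : ℝ :=
  ∑ j ∈ Finset.range (k + 2), ‖iteratedFDeriv ℝ j (fun y => V (y, 0)) x‖ ^ 2
    + ∑ j ∈ Finset.range (k + 1), ‖iteratedFDeriv ℝ j (fun y => timeD V (y, 0)) x‖ ^ 2

lemma dataNorm_nonneg (k : ℕ) (V : EuclideanSpace ℝ (Fin N) × ℝ → ℝ)
    (x : EuclideanSpace ℝ (Fin N)) : 0 ≤ dataNorm k V x :=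
  add_nonneg (Finset.sum_nonneg fun _ _ => norm_nonneg _)
    (Finset.sum_nonneg fun _ _ => norm_nonneg _)

lemma dataSq_nonneg (k : ℕ) (V : EuclideanSpace ℝ (Fin N) × ℝ → ℝ)
    (x : EuclideanSpace ℝ (Fin N)) : 0 ≤ dataSq k V x :=
  add_nonneg (Finset.sum_nonneg fun _ _ => sq_nonneg _)
    (Finset.sum_nonneg fun _ _ => sq_nonneg _)

lemma dataNorm_sq_le (k : ℕ) (V : EuclideanSpace ℝ (Fin N) × ℝ → ℝ)
    (x : EuclideanSpace ℝ (Fin N)) : dataNorm k V x ^ 2 ≤ 2 * (k + 2) * dataSq k V x := by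
  have h1 := sq_sum_le_card_mul_sum_sq (s := Finset.range (k + 2))
    (f := fun j => ‖iteratedFDeriv ℝ j (fun y => V (y, 0)) x‖)
  have h2 := sq_sum_le_card_mul_sum_sq (s := Finset.range (k + 1))
    (f := fun j => ‖iteratedFDeriv ℝ j (fun y => timeD V (y, 0)) x‖)
  have h3 : 0 ≤ ∑ j ∈ Finset.range (k + 1), ‖iteratedFDeriv ℝ j (fun y => timeD V (y, 0)) x‖ ^ 2 :=
    Finset.sum_nonneg fun _ _ => sq_nonneg _
  rw [Finset.card_range] at h1 h2
  push_cast at h1 h2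
  unfold dataNorm dataSq
  refine add_sq_le.trans ?_
  linarith

lemma norm_iteratedFDeriv_data_le (k : ℕ) (hΩ : IsOpen Ω) (ha : ContDiff ℝ (k : ℕ) a) (R₀ : ℝ)
    (j : ℕ) :
    ∃ C ≥ (0 : ℝ), ∀ V, IsDampedWave Ω a R₀ V → ∀ x ∈ Ω, ‖x‖ ≤ R₀ → ∀ p : ℕ, p + j ≤ k + 1 →
      ‖iteratedFDeriv ℝ p (fun y => (timeD^[j] V) (y, 0)) x‖ ≤ C * dataNorm k V x := by
  induction j using Nat.twoStepInduction with
  | zero =>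
    refine ⟨1, zero_le_one, fun V _ x _ _ p hp => ?_⟩
    have h1 := Finset.single_le_sum
      (f := fun j => ‖iteratedFDeriv ℝ j (fun y => V (y, 0)) x‖) (fun _ _ => norm_nonneg _)
      (Finset.mem_range.2 (by omega : p < k + 2))
    have h2 : 0 ≤ ∑ j ∈ Finset.range (k + 1), ‖iteratedFDeriv ℝ j (fun y => timeD V (y, 0)) x‖ :=
      Finset.sum_nonneg fun _ _ => norm_nonneg _
    simp only [Function.iterate_zero, id, dataNorm]
    linarith
  | one =>
    refine ⟨1, zero_le_one, fun V _ x _ _ p hp => ?_⟩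
    have h1 := Finset.single_le_sum
      (f := fun j => ‖iteratedFDeriv ℝ j (fun y => timeD V (y, 0)) x‖) (fun _ _ => norm_nonneg _)
      (Finset.mem_range.2 (by omega : p < k + 1))
    have h2 : 0 ≤ ∑ j ∈ Finset.range (k + 2), ‖iteratedFDeriv ℝ j (fun y => V (y, 0)) x‖ :=
      Finset.sum_nonneg fun _ _ => norm_nonneg _
    simp only [Function.iterate_one, dataNorm]
    linarith
  | more j ih0 ih1 =>
    obtain ⟨C₀, hC₀, h0⟩ := ih0
    obtain ⟨C₁, hC₁, h1⟩ := ih1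
    have hab : ∀ i : ℕ, ∃ D ≥ (0 : ℝ), i ≤ k → ∀ x : EuclideanSpace ℝ (Fin N), ‖x‖ ≤ R₀ →
        ‖iteratedFDeriv ℝ i a x‖ ≤ D := by
      intro i
      by_cases hi : i ≤ k
      · obtain ⟨D, hD⟩ := (isCompact_closedBall (0 : EuclideanSpace ℝ (Fin N))
          R₀).exists_bound_of_continuousOn
          (ha.continuous_iteratedFDeriv (m := i) (by exact_mod_cast hi)).continuousOn
        exact ⟨max D 0, le_max_right _ _, fun _ x hx => (hD x (by simpa using hx)).trans
          (le_max_left _ _)⟩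
      · exact ⟨0, le_rfl, fun h => absurd h hi⟩
    choose D hD0 hD using hab
    refine ⟨N * C₀ + ∑ p ∈ Finset.range (k + 1), ∑ i ∈ Finset.range (p + 1),
      (p.choose i : ℝ) * D i * C₁, add_nonneg (mul_nonneg (Nat.cast_nonneg N) hC₀)
        (Finset.sum_nonneg fun p _ => Finset.sum_nonneg fun i _ =>
          mul_nonneg (mul_nonneg (Nat.cast_nonneg _) (hD0 i)) hC₁), ?_⟩
    intro V hV x hx hxR p hp
    have hsm := (hV.iterate_timeD j).smooth
    have hsm1 := (hV.iterate_timeD (j + 1)).smooth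
    have hloc : (fun y => (timeD^[j + 2] V) (y, 0)) =ᶠ[𝓝 x]
        fun y => spaceLap (timeD^[j] V) (y, 0) - a y * (timeD^[j + 1] V) (y, 0) := by
      filter_upwards [hΩ.mem_nhds hx] with y hy
      have := (hV.iterate_timeD j).eqn_of_nonneg hy le_rfl
      simpa only [Function.iterate_succ_apply', spaceLap] using this
    rw [(hloc.iteratedFDeriv ℝ p).self_of_nhds]
    have hap : ContDiff ℝ p a := ha.of_le (by exact_mod_cast (by omega : p ≤ k))
    have hs1 : ContDiff ℝ p fun y => spaceLap (timeD^[j] V) (y, 0) :=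
      ContDiff.sum fun i _ => (contDiff_slice ((hsm.spaceD i).spaceD i) 0).of_le
        (by exact_mod_cast le_top)
    have hs2 : ContDiff ℝ p fun y => (timeD^[j + 1] V) (y, 0) :=
      (contDiff_slice hsm1 0).of_le (by exact_mod_cast le_top)
    rw [fun_iteratedFDeriv_sub_apply hs1.contDiffAt (hap.mul hs2).contDiffAt]
    have hd := dataNorm_nonneg k V x
    refine (norm_sub_le _ _).trans ?_
    rw [add_mul]
    refine add_le_add ?_ ?_
    · refine (norm_iteratedFDeriv_spaceLap_slice_le hsm 0 p x).trans ?_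
      rw [mul_assoc]
      exact mul_le_mul_of_nonneg_left (h0 V hV x hx hxR (p + 2) (by omega)) (Nat.cast_nonneg N)
    · refine (norm_iteratedFDeriv_mul_le hap hs2 x le_rfl).trans ?_
      have h3 : ∑ i ∈ Finset.range (p + 1), (p.choose i : ℝ) * ‖iteratedFDeriv ℝ i a x‖
            * ‖iteratedFDeriv ℝ (p - i) (fun y => (timeD^[j + 1] V) (y, 0)) x‖
          ≤ (∑ i ∈ Finset.range (p + 1), (p.choose i : ℝ) * D i * C₁) * dataNorm k V x := by
        rw [Finset.sum_mul]
        refine Finset.sum_le_sum fun i hi => ?_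
        have hip : i < p + 1 := Finset.mem_range.1 hi
        rw [mul_assoc _ C₁]
        exact mul_le_mul (mul_le_mul_of_nonneg_left (hD i (by omega) x hxR) (Nat.cast_nonneg _))
          (h1 V hV x hx hxR (p - i) (by omega)) (norm_nonneg _)
          (mul_nonneg (Nat.cast_nonneg _) (hD0 i))
      refine h3.trans (mul_le_mul_of_nonneg_right ?_ hd)
      exact Finset.single_le_sum
        (f := fun p => ∑ i ∈ Finset.range (p + 1), (p.choose i : ℝ) * D i * C₁)
        (fun q _ => Finset.sum_nonneg fun i _ =>
          mul_nonneg (mul_nonneg (Nat.cast_nonneg _) (hD0 i)) hC₁)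
        (Finset.mem_range.2 (by omega : p < k + 1))

lemma norm_iteratedFDeriv_eq_zero {f : EuclideanSpace ℝ (Fin N) → ℝ} {R : ℝ}
    (h : ∀ x, R < ‖x‖ → f x = 0) (j : ℕ) {x : EuclideanSpace ℝ (Fin N)} (hx : R < ‖x‖) :
    ‖iteratedFDeriv ℝ j f x‖ = 0 := by
  have : f =ᶠ[𝓝 x] fun _ => 0 := by
    filter_upwards [(isOpen_lt continuous_const continuous_norm).mem_nhds hx] with y hy
      using h y hy
  rw [(this.iteratedFDeriv ℝ j).self_of_nhds]
  have := congrFun (iteratedFDeriv_fun_zero (𝕜 := ℝ) (E := EuclideanSpace ℝ (Fin N)) (F := ℝ)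
    (n := j)) x
  simp only [Pi.zero_def] at this
  rw [this, norm_zero]

lemma integrable_norm_iteratedFDeriv_sq {f : EuclideanSpace ℝ (Fin N) → ℝ} {R : ℝ}
    (hf : ContDiff ℝ (⊤ : ℕ∞) f) (h : ∀ x, R < ‖x‖ → f x = 0) (j : ℕ) :
    Integrable fun x => ‖iteratedFDeriv ℝ j f x‖ ^ 2 :=
  ((hf.continuous_iteratedFDeriv (by exact_mod_cast le_top)).norm.pow 2).integrable_of_hasCompactSupport
    (hasCompactSupport_of_radius (R := R) fun x hx => by
      simp [norm_eq_zero.1 (norm_iteratedFDeriv_eq_zero h j hx)])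

/-- The squared Sobolev norm of the initial data. -/
noncomputable def dataEnergy (Ω : Set (EuclideanSpace ℝ (Fin N))) (k : ℕ)
    (V : EuclideanSpace ℝ (Fin N) × ℝ → ℝ) : ℝ :=
  (∑ j ∈ Finset.range (k + 2), ∫ x in Ω, ‖iteratedFDeriv ℝ j (fun y => V (y, 0)) x‖ ^ 2)
    + ∑ j ∈ Finset.range (k + 1), ∫ x in Ω, ‖iteratedFDeriv ℝ j (fun y => timeD V (y, 0)) x‖ ^ 2

lemma IsDampedWave.integrable_dataSq {V : EuclideanSpace ℝ (Fin N) × ℝ → ℝ}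
    (hV : IsDampedWave Ω a R₀ V) (k : ℕ) :
    IntegrableOn (dataSq k V) Ω ∧ ∫ x in Ω, dataSq k V x = dataEnergy Ω k V := by
  have i1 : ∀ j ∈ Finset.range (k + 2),
      Integrable (fun x => ‖iteratedFDeriv ℝ j (fun y => V (y, 0)) x‖ ^ 2) (volume.restrict Ω) :=
    fun j _ => (integrable_norm_iteratedFDeriv_sq (R := R₀) (contDiff_slice hV.smooth 0)
      (fun x hx => hV.supp 0 le_rfl x (by simpa using hx)) j).restrict
  have i2 : ∀ j ∈ Finset.range (k + 1),
      Integrable (fun x => ‖iteratedFDeriv ℝ j (fun y => timeD V (y, 0)) x‖ ^ 2)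
        (volume.restrict Ω) :=
    fun j _ => (integrable_norm_iteratedFDeriv_sq (R := R₀) (contDiff_slice hV.smooth.timeD 0)
      (fun x hx => hV.supp_timeD 0 le_rfl x (by simpa using hx)) j).restrict
  have s1 := integrable_finsetSum _ i1
  have s2 := integrable_finsetSum _ i2
  refine ⟨s1.add s2, ?_⟩
  unfold dataSq dataEnergy
  rw [integral_add s1 s2, integral_finsetSum _ i1, integral_finsetSum _ i2]

lemma gradSq_eq_norm_sq {V : EuclideanSpace ℝ (Fin N) × ℝ → ℝ} (hV : ContDiff ℝ (⊤ : ℕ∞) V)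
    (x : EuclideanSpace ℝ (Fin N)) (s : ℝ) :
    gradSq V (x, s) = ‖fderiv ℝ (fun y => V (y, s)) x‖ ^ 2 := by
  rw [norm_sq_eq_sum_single]
  exact Finset.sum_congr rfl fun i _ => by rw [fderiv_slice_single hV.differentiable_of_top]

/-- The initial energies are controlled by the Sobolev norms of the initial data. -/
lemma energy_zero_le (k : ℕ) (hΩ : IsOpen Ω) (ha : ContDiff ℝ (k : ℕ) a)
    (hB : Continuous B) (hν : 0 ≤ ν) (ht₀ : 0 ≤ t₀) {j : ℕ} (hj : j ≤ k) :
    ∃ C ≥ (0 : ℝ), ∀ V, IsDampedWave Ω a R₀ V →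
      energy Ω a B β ν t₀ (timeD^[j] V) 0 ≤ C * dataEnergy Ω k V := by
  obtain ⟨C₀, hC₀, h0⟩ := norm_iteratedFDeriv_data_le k hΩ ha R₀ j
  obtain ⟨C₁, hC₁, h1⟩ := norm_iteratedFDeriv_data_le k hΩ ha R₀ (j + 1)
  have hK := isCompact_closedBall (0 : EuclideanSpace ℝ (Fin N)) R₀
  have hcE : Continuous fun x => expWeight β B x 0 := by
    unfold expWeight
    fun_prop
  obtain ⟨W, hW⟩ := hK.exists_bound_of_continuousOn hcE.continuousOn
  obtain ⟨D, hD⟩ := hK.exists_bound_of_continuousOn ha.continuous.continuousOn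
  set F := |W| * ((ν * t₀ * (C₀ ^ 2 + C₁ ^ 2) + (C₀ ^ 2 + C₁ ^ 2) + |D| * C₀ ^ 2)
    * (2 * (k + 2))) with hF
  refine ⟨F, by positivity, fun V hV => ?_⟩
  have hVj := hV.iterate_timeD j
  obtain ⟨iD, eD⟩ := hV.integrable_dataSq k
  rw [← eD, ← integral_const_mul]
  refine setIntegral_mono_on (integrable_weighted (R₀ := R₀) hB
    (continuous_energyDensity ha.continuous hVj.smooth).continuousOn
    (fun s hs x hx => hVj.energyDensity_eq_zero hs hx) le_rfl) (iD.const_mul F) hΩ.measurableSet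
    fun x hx => ?_
  have hS := dataSq_nonneg k V x
  by_cases hxR : ‖x‖ ≤ R₀
  · have hxK : x ∈ Metric.closedBall (0 : EuclideanSpace ℝ (Fin N)) R₀ := by simpa using hxR
    have b0 := h0 V hV x hx hxR 0 (by omega)
    have b1 := h0 V hV x hx hxR 1 (by omega)
    have b2 := h1 V hV x hx hxR 0 (by omega)
    rw [norm_iteratedFDeriv_zero, Function.iterate_succ_apply'] at b2
    rw [norm_iteratedFDeriv_zero] at b0
    rw [norm_iteratedFDeriv_one] at b1
    have hd := dataNorm_nonneg k V x
    have q0 : (timeD^[j] V) (x, 0) ^ 2 ≤ C₀ ^ 2 * dataNorm k V x ^ 2 := by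
      rw [← mul_pow, ← sq_abs]
      exact pow_le_pow_left₀ (abs_nonneg _) b0 2
    have q2 : timeD (timeD^[j] V) (x, 0) ^ 2 ≤ C₁ ^ 2 * dataNorm k V x ^ 2 := by
      rw [← mul_pow, ← sq_abs]
      exact pow_le_pow_left₀ (abs_nonneg _) b2 2
    have q1 : gradSq (timeD^[j] V) (x, 0) ≤ C₀ ^ 2 * dataNorm k V x ^ 2 := by
      rw [gradSq_eq_norm_sq hVj.smooth, ← mul_pow]
      exact pow_le_pow_left₀ (norm_nonneg _) b1 2
    have hw : expWeight β B x 0 ≤ |W| := (le_abs_self _).trans ((hW x hxK).trans (le_abs_self _))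
    have haD : a x ≤ |D| := (le_abs_self _).trans ((hD x hxK).trans (le_abs_self _))
    have hE : energyDensity a ν t₀ (timeD^[j] V) x 0
        ≤ (ν * t₀ * (C₀ ^ 2 + C₁ ^ 2) + (C₀ ^ 2 + C₁ ^ 2) + |D| * C₀ ^ 2)
          * dataNorm k V x ^ 2 := by
      have e1 : ν * (t₀ + 0) * (gradSq (timeD^[j] V) (x, 0) + timeD (timeD^[j] V) (x, 0) ^ 2)
          ≤ ν * t₀ * (C₀ ^ 2 * dataNorm k V x ^ 2 + C₁ ^ 2 * dataNorm k V x ^ 2) := by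
        rw [add_zero]
        gcongr
      have e2 := two_mul_le_add_sq ((timeD^[j] V) (x, 0)) (timeD (timeD^[j] V) (x, 0))
      have e3 : a x * (timeD^[j] V) (x, 0) ^ 2 ≤ |D| * (C₀ ^ 2 * dataNorm k V x ^ 2) := by
        gcongr
      unfold energyDensity
      linarith
    have hpos := expWeight_pos β B x 0
    have hc : 0 ≤ ν * t₀ * (C₀ ^ 2 + C₁ ^ 2) + (C₀ ^ 2 + C₁ ^ 2) + |D| * C₀ ^ 2 := by positivity
    calc expWeight β B x 0 * energyDensity a ν t₀ (timeD^[j] V) x 0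
        ≤ expWeight β B x 0 * ((ν * t₀ * (C₀ ^ 2 + C₁ ^ 2) + (C₀ ^ 2 + C₁ ^ 2) + |D| * C₀ ^ 2)
          * (2 * (k + 2) * dataSq k V x)) := by
          gcongr
          exact hE.trans (mul_le_mul_of_nonneg_left (dataNorm_sq_le k V x) hc)
      _ ≤ |W| * ((ν * t₀ * (C₀ ^ 2 + C₁ ^ 2) + (C₀ ^ 2 + C₁ ^ 2) + |D| * C₀ ^ 2)
          * (2 * (k + 2) * dataSq k V x)) := by
          gcongr
      _ = F * dataSq k V x := by rw [hF]; ring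
  · rw [hVj.energyDensity_eq_zero le_rfl (by simpa using hxR), mul_zero]
    positivity

lemma lyapunov_zero_le (k : ℕ) (hΩ : IsOpen Ω) (ha : ContDiff ℝ (k : ℕ) a)
    (hB : Continuous B) (hν : 0 ≤ ν) (ht₀ : 0 ≤ t₀) (m : ℝ) {θ : ℝ} (hθ : 0 ≤ θ) :
    ∃ C ≥ (0 : ℝ), ∀ V, IsDampedWave Ω a R₀ V →
      lyapunov Ω a B β ν t₀ m θ k V 0 ≤ C * dataEnergy Ω k V := by
  have h : ∀ j : ℕ, ∃ C ≥ (0 : ℝ), j ≤ k → ∀ V, IsDampedWave Ω a R₀ V →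
      energy Ω a B β ν t₀ (timeD^[j] V) 0 ≤ C * dataEnergy Ω k V := by
    intro j
    by_cases hj : j ≤ k
    · obtain ⟨C, hC, h⟩ := energy_zero_le (R₀ := R₀) (β := β) k hΩ ha hB hν ht₀ hj
      exact ⟨C, hC, fun _ => h⟩
    · exact ⟨0, le_rfl, fun h => absurd h hj⟩
  choose C hC hle using h
  refine ⟨∑ j ∈ Finset.range (k + 1), θ ^ j * ((t₀ + 0) ^ (m + 2 * (j : ℝ)) * C j),
    Finset.sum_nonneg fun j _ => mul_nonneg (pow_nonneg hθ j)
      (mul_nonneg (Real.rpow_nonneg (by simpa using ht₀) _) (hC j)), fun V hV => ?_⟩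
  unfold lyapunov
  rw [Finset.sum_mul]
  refine Finset.sum_le_sum fun j hj => ?_
  rw [mul_assoc, mul_assoc]
  exact mul_le_mul_of_nonneg_left (mul_le_mul_of_nonneg_left
    (hle j (by have := Finset.mem_range.1 hj; omega) V hV)
    (Real.rpow_nonneg (by simpa using ht₀) _)) (pow_nonneg hθ j)

end InitialData

section Parameters

variable {N : ℕ}

lemma exists_decay_parameters {r ε : ℝ} (hr : 0 < r) (hε : 0 < ε) :
    ∃ m β δ η : ℝ, 0 < m ∧ m < β ∧ r - ε ≤ m ∧ 0 < δ ∧ 0 < η ∧ η < 1 ∧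
      β * (1 / r + δ) * (1 + η) ≤ (1 - η) ^ 2 ∧ β * (1 / r + δ) ≤ 1 := by
  set e := min ε (r / 2) with he
  have he0 : 0 < e := lt_min hε (by positivity)
  have he1 : e ≤ ε := min_le_left _ _
  have he2 : e ≤ r / 2 := min_le_right _ _
  have hβ : 0 < r - e / 2 := by linarith
  set q := (r - e / 2) / r with hq
  have hq1 : q < 1 := by rw [hq, div_lt_one hr]; linarith
  have hq0 : 0 < q := div_pos hβ hr
  have key : (r - e / 2) * (1 / r + (1 - q) / (2 * (r - e / 2))) = (1 + q) / 2 := by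
    have : (r - e / 2) * (1 / r + (1 - q) / (2 * (r - e / 2)))
        = (r - e / 2) / r + (1 - q) / 2 := by
      rw [mul_add, mul_one_div]
      congr 1
      have h : ∀ b : ℝ, b ≠ 0 → b * ((1 - q) / (2 * b)) = (1 - q) / 2 := fun b hb => by field_simp
      exact h _ hβ.ne'
    rw [this, ← hq]
    ring
  refine ⟨r - e, r - e / 2, (1 - q) / (2 * (r - e / 2)), (1 - q) / 8, by linarith, by linarith,
    by linarith, div_pos (by linarith) (by linarith), by linarith, by linarith, ?_, ?_⟩
  · rw [key]
    nlinarith [sq_nonneg (1 - q)]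
  · rw [key]
    linarith

variable {a A : EuclideanSpace ℝ (Fin N) → ℝ} {a₁ a₂ α A₂ h : ℝ}

lemma exists_shift (ha₁ : 0 < a₁) (hα : 0 ≤ α)
    (ha : ∀ x : EuclideanSpace ℝ (Fin N), a₁ * (1 + ‖x‖) ^ (-α) ≤ a x)
    (hA : ContDiff ℝ 1 A) (hh : 0 < h) {R : ℝ} (hR : 0 < R)
    (hgrad : ∀ x : EuclideanSpace ℝ (Fin N), R ≤ ‖x‖ → ‖gradient A x‖ ^ 2 ≤ h * a x * A x) :
    ∃ c₀ ≥ (0 : ℝ), ∀ x, ∑ i, partialD i A x ^ 2 ≤ h * a x * (A x + c₀) := by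
  have hApos : ∀ x, 0 < a x := fun x =>
    lt_of_lt_of_le (mul_pos ha₁ (Real.rpow_pos_of_pos (by positivity) _)) (ha x)
  have hc : Continuous fun x => ∑ i, partialD i A x ^ 2 :=
    continuous_finsetSum _ fun i _ => (continuous_partialD hA i).pow 2
  have hAc := hA.continuous
  obtain ⟨D, hD⟩ := (isCompact_closedBall (0 : EuclideanSpace ℝ (Fin N))
    R).exists_bound_of_continuousOn hc.continuousOn
  obtain ⟨D', hD'⟩ := (isCompact_closedBall (0 : EuclideanSpace ℝ (Fin N))
    R).exists_bound_of_continuousOn hAc.continuousOn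
  have hmin : 0 < a₁ * (1 + R) ^ (-α) := by positivity
  set c₁ := |D| / (h * (a₁ * (1 + R) ^ (-α))) with hc₁
  have hc₁0 : 0 ≤ c₁ := by positivity
  refine ⟨c₁ + |D'|, by positivity, fun x => ?_⟩
  by_cases hx : ‖x‖ ≤ R
  · have hxK : x ∈ Metric.closedBall (0 : EuclideanSpace ℝ (Fin N)) R := by simpa using hx
    have h1 : ∑ i, partialD i A x ^ 2 ≤ |D| :=
      (le_abs_self _).trans ((hD x hxK).trans (le_abs_self _))
    have h2 : a₁ * (1 + R) ^ (-α) ≤ a x := by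
      refine le_trans (mul_le_mul_of_nonneg_left ?_ ha₁.le) (ha x)
      exact Real.rpow_le_rpow_of_nonpos (by positivity) (by linarith) (by linarith)
    have h3 : c₁ ≤ A x + (c₁ + |D'|) := by
      have := (neg_abs_le (A x)).trans' (neg_le_neg ((hD' x hxK).trans (le_abs_self _)))
      linarith
    calc ∑ i, partialD i A x ^ 2 ≤ |D| := h1
      _ = h * (a₁ * (1 + R) ^ (-α)) * c₁ := by rw [hc₁]; field_simp
      _ ≤ h * a x * (A x + (c₁ + |D'|)) := by
        have := (hApos x).le
        gcongr
  · have h1 := hgrad x (not_le.1 hx).le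
    rw [norm_gradient_sq] at h1
    refine h1.trans (mul_le_mul_of_nonneg_left ?_ (mul_nonneg hh.le (hApos x).le))
    linarith [abs_nonneg D']

lemma shift_le (ha₁ : 0 < a₁) (hA₂ : 0 < A₂) (hα : α < 1) {R₀ c₀ : ℝ} (hR₀ : 0 < R₀)
    (hc₀ : 0 ≤ c₀) (ha : ∀ x : EuclideanSpace ℝ (Fin N), a₁ * (1 + ‖x‖) ^ (-α) ≤ a x)
    (hA : ∀ x : EuclideanSpace ℝ (Fin N), A x ≤ A₂ * (1 + ‖x‖) ^ (2 - α)) {t : ℝ} (ht : 0 ≤ t)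
    {x : EuclideanSpace ℝ (Fin N)} (hx : ‖x‖ ≤ R₀ + t) :
    (A x + c₀) / (1 + t) ^ 2 ≤ (A₂ + c₀) * (1 + R₀) ^ 2 / a₁ * a x := by
  have hp : 0 < 1 + ‖x‖ := by positivity
  have h1 : (1 : ℝ) ≤ (1 + ‖x‖) ^ (2 - α) :=
    Real.one_le_rpow (by linarith [norm_nonneg x]) (by linarith)
  have h2 : A x + c₀ ≤ (A₂ + c₀) * (1 + ‖x‖) ^ (2 - α) := by
    nlinarith [hA x]
  have h3 : (1 + ‖x‖) ^ (2 - α) = (1 + ‖x‖) ^ 2 * (1 + ‖x‖) ^ (-α) := by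
    rw [← Real.rpow_natCast, ← Real.rpow_add hp]
    norm_num [sub_eq_add_neg]
  have h4 : 1 + ‖x‖ ≤ (1 + R₀) * (1 + t) := by nlinarith
  have h5 : (1 + ‖x‖) ^ 2 ≤ (1 + R₀) ^ 2 * (1 + t) ^ 2 := by
    rw [← mul_pow]
    gcongr
  have h6 : (1 + ‖x‖) ^ (-α) ≤ a x / a₁ := by
    rw [le_div_iff₀ ha₁]
    linarith [ha x]
  rw [div_le_iff₀ (by positivity)]
  calc A x + c₀ ≤ (A₂ + c₀) * ((1 + ‖x‖) ^ 2 * (1 + ‖x‖) ^ (-α)) := by rw [← h3]; exact h2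
    _ ≤ (A₂ + c₀) * (((1 + R₀) ^ 2 * (1 + t) ^ 2) * (a x / a₁)) := by gcongr
    _ = (A₂ + c₀) * (1 + R₀) ^ 2 / a₁ * a x * (1 + t) ^ 2 := by ring

lemma exists_time_shift (ha₁ : 0 < a₁) (hα : 0 ≤ α) (hα1 : α < 1) {R₀ Λ : ℝ} (hR₀ : 0 < R₀)
    (hΛ : 0 < Λ) (ha : ∀ x : EuclideanSpace ℝ (Fin N), a₁ * (1 + ‖x‖) ^ (-α) ≤ a x) :
    ∃ t₀ ≥ (1 : ℝ), ∀ t ≥ (0 : ℝ), ∀ x, ‖x‖ ≤ R₀ + t → Λ ≤ a x * (t₀ + t) := by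
  have hα' : 0 < 1 - α := by linarith
  set t₁ := (Λ / a₁) ^ (1 / (1 - α)) with ht₁
  have ht₁0 : 0 < t₁ := by positivity
  refine ⟨1 + R₀ + t₁, by linarith, fun t ht x hx => ?_⟩
  have hT : 0 < 1 + R₀ + t₁ + t := by linarith
  have h1 : Λ / a₁ = t₁ ^ (1 - α) := by
    rw [ht₁, ← Real.rpow_mul (by positivity), one_div_mul_cancel hα'.ne', Real.rpow_one]
  have h2 : t₁ ^ (1 - α) ≤ (1 + R₀ + t₁ + t) ^ (1 - α) :=
    Real.rpow_le_rpow ht₁0.le (by linarith) hα'.le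
  have h3 : (1 + R₀ + t₁ + t) ^ (1 - α)
      = (1 + R₀ + t₁ + t) ^ (-α) * (1 + R₀ + t₁ + t) := by
    rw [sub_eq_neg_add, Real.rpow_add_one hT.ne']
  have h4 : (1 + R₀ + t₁ + t) ^ (-α) ≤ (1 + ‖x‖) ^ (-α) :=
    Real.rpow_le_rpow_of_nonpos (by positivity) (by linarith) (by linarith)
  calc Λ = a₁ * (Λ / a₁) := by field_simp
    _ ≤ a₁ * ((1 + R₀ + t₁ + t) ^ (-α) * (1 + R₀ + t₁ + t)) := by
      rw [h1, ← h3]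
      gcongr
    _ ≤ a₁ * ((1 + ‖x‖) ^ (-α) * (1 + R₀ + t₁ + t)) := by gcongr
    _ = a₁ * (1 + ‖x‖) ^ (-α) * (1 + R₀ + t₁ + t) := by ring
    _ ≤ a x * (1 + R₀ + t₁ + t) := by
      gcongr
      exact ha x

lemma lap_add_const (A : EuclideanSpace ℝ (Fin N) → ℝ) (c : ℝ) (x : EuclideanSpace ℝ (Fin N)) :
    lap (fun y => A y + c) x = lap A x := by
  simp [lap, fderiv_add_const]

end Parameters

section Decay

variable {N : ℕ} {Ω : Set (EuclideanSpace ℝ (Fin N))} {a B : EuclideanSpace ℝ (Fin N) → ℝ}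
  {R₀ β ν η h K Λ t₀ : ℝ}

lemma dataEnergy_nonneg (k : ℕ) (V : EuclideanSpace ℝ (Fin N) × ℝ → ℝ) :
    0 ≤ dataEnergy Ω k V :=
  add_nonneg (Finset.sum_nonneg fun _ _ => integral_nonneg fun _ => sq_nonneg _)
    (Finset.sum_nonneg fun _ _ => integral_nonneg fun _ => sq_nonneg _)

/-- Weighted decay of the time derivatives of a damped wave in terms of its initial data. -/
lemma exists_weighted_decay (hΩ : IsOpen Ω) (H : IsAdmissible a B R₀ β ν η h K Λ t₀) {k : ℕ}
    (ha : ContDiff ℝ (k : ℕ) a) {m : ℝ} (hm0 : 0 < m) (hm : m < β)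
    (hνM : (m + 2 * k + 1) * ν ≤ 2 * η)
    (hbig : (m + 2 * k + 1) * ν + β * K / η + (m + 2 * k) ^ 2 / (β - m) + 2 ≤ ν / 2 * Λ)
    {p : ℝ} (hp : -(m + 2 * (k : ℝ)) ≤ p) :
    ∃ C > (0 : ℝ), ∀ V, IsDampedWave Ω a R₀ V → ∀ t ≥ (0 : ℝ),
      weightedSq Ω a B β (timeD^[k] V) t ≤ C * (t₀ + t) ^ p * dataEnergy Ω k V ∧
      weightedGradSq Ω B β (timeD^[k] V) t ≤ C * (t₀ + t) ^ (p - 1) * dataEnergy Ω k V := by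
  have hν := H.ν_pos
  set θ := ν / (4 * (k + 1)) with hθ
  have hθ0 : 0 < θ := by positivity
  have hθk : 2 * (k : ℝ) * θ ≤ ν / 2 := by
    have h1 : θ * (4 * (k + 1)) = ν := by rw [hθ]; field_simp
    nlinarith
  obtain ⟨C, hC, hL⟩ := lyapunov_zero_le (R₀ := R₀) (β := β) k hΩ ha H.smooth_B.continuous hν.le
    (by linarith [H.one_le_t₀] : (0 : ℝ) ≤ t₀) m hθ0.le
  set D := C / θ ^ k with hD
  have hD0 : 0 ≤ D := by positivity
  refine ⟨(2 + 1 / ν) * D + 1, by positivity, fun V hV t ht => ?_⟩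
  have hT1 : 1 ≤ t₀ + t := by linarith [H.one_le_t₀]
  have hT : 0 < t₀ + t := by linarith
  have hI := dataEnergy_nonneg (Ω := Ω) k V
  have hE : energy Ω a B β ν t₀ (timeD^[k] V) t ≤ D * ((t₀ + t) ^ p * dataEnergy Ω k V) := by
    refine (energy_decay hΩ H hV hm0 hm hθ0 hθk hνM hbig ht).trans ?_
    calc lyapunov Ω a B β ν t₀ m θ k V 0 / θ ^ k * (t₀ + t) ^ (-(m + 2 * (k : ℝ)))
        ≤ C * dataEnergy Ω k V / θ ^ k * (t₀ + t) ^ p := by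
          gcongr
          · exact hL V hV
      _ = D * ((t₀ + t) ^ p * dataEnergy Ω k V) := by rw [hD]; ring
  have hco := le_energy hΩ H (hV.iterate_timeD k) ht
  have hS := weightedSq_nonneg (Ω := Ω) (B := B) (β := β) (V := timeD^[k] V) H.a_pos t
  have hG := weightedGradSq_nonneg (Ω := Ω) (B := B) (β := β) (V := timeD^[k] V) t
  have hX : 0 ≤ (t₀ + t) ^ p * dataEnergy Ω k V := by positivity
  have hinv : 0 ≤ 1 / ν := by positivity
  constructor
  · have hG' : 0 ≤ ν * (t₀ + t) * weightedGradSq Ω B β (timeD^[k] V) t := by positivity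
    have h1 := mul_nonneg (mul_nonneg hinv hD0) hX
    rw [mul_assoc]
    nlinarith
  · have h1 : weightedGradSq Ω B β (timeD^[k] V) t
        ≤ 1 / ν * D * ((t₀ + t) ^ (p - 1) * dataEnergy Ω k V) := by
      have h2 : ν * (t₀ + t) * weightedGradSq Ω B β (timeD^[k] V) t
          ≤ D * ((t₀ + t) ^ p * dataEnergy Ω k V) := by linarith
      rw [Real.rpow_sub_one hT.ne']
      calc weightedGradSq Ω B β (timeD^[k] V) t
          = ν * (t₀ + t) * weightedGradSq Ω B β (timeD^[k] V) t / (ν * (t₀ + t)) := by field_simp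
        _ ≤ D * ((t₀ + t) ^ p * dataEnergy Ω k V) / (ν * (t₀ + t)) := by gcongr
        _ = 1 / ν * D * ((t₀ + t) ^ p / (t₀ + t) * dataEnergy Ω k V) := by field_simp
    have hY : 0 ≤ (t₀ + t) ^ (p - 1) * dataEnergy Ω k V := by positivity
    rw [mul_assoc]
    nlinarith [mul_nonneg hD0 hY]

end Decay

section Assembly

variable {N : ℕ} {Ω : Set (EuclideanSpace ℝ (Fin N))} {a : EuclideanSpace ℝ (Fin N) → ℝ}
  {R₀ : ℝ} {u : EuclideanSpace ℝ (Fin N) → ℝ → ℝ}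

lemma iterate_deriv_eq_iterate_timeD
    (hu : ContDiff ℝ (⊤ : ℕ∞) (fun p : EuclideanSpace ℝ (Fin N) × ℝ => u p.1 p.2)) (k : ℕ)
    (x : EuclideanSpace ℝ (Fin N)) :
    deriv^[k] (u x) = fun t => (timeD^[k] fun p => u p.1 p.2) (x, t) := by
  have hsm : ∀ j : ℕ, ContDiff ℝ (⊤ : ℕ∞) (timeD^[j] fun p => u p.1 p.2) := by
    intro j
    induction j with
    | zero => exact hu
    | succ j ih => rw [Function.iterate_succ_apply']; exact ih.timeD
  induction k with
  | zero => rfl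
  | succ k ih =>
    rw [Function.iterate_succ_apply', ih]
    funext t
    rw [Function.iterate_succ_apply']
    exact (hasDerivAt_timeD (hsm k).differentiable_of_top x t).deriv

lemma isDampedWave_uncurry
    (hu : ContDiff ℝ (⊤ : ℕ∞) (fun p : EuclideanSpace ℝ (Fin N) × ℝ => u p.1 p.2))
    (heq : ∀ x ∈ Ω, ∀ s > (0 : ℝ),
      deriv (deriv (u x)) s - lap (fun y => u y s) x + a x * deriv (u x) s = 0)
    (hbd : ∀ x ∈ frontier Ω, ∀ s > (0 : ℝ), u x s = 0)
    (hsupp : ∀ s ≥ (0 : ℝ), ∀ x : EuclideanSpace ℝ (Fin N), R₀ + s < ‖x‖ → u x s = 0) :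
    IsDampedWave Ω a R₀ (fun p => u p.1 p.2) where
  smooth := hu
  eqn x hx s hs := by
    have h := heq x hx s hs
    have h1 : deriv (u x) = fun t => timeD (fun p => u p.1 p.2) (x, t) :=
      iterate_deriv_eq_iterate_timeD hu 1 x
    have h2 : deriv (deriv (u x)) = fun t => timeD (timeD fun p => u p.1 p.2) (x, t) :=
      iterate_deriv_eq_iterate_timeD hu 2 x
    rw [h2, h1, lap_slice hu x s] at h
    exact h
  bdry := hbd
  supp := hsupp

end Assembly

/-- **Corollary 3.3.** If moreover `|x|^α a(x) → a₀ > 0` as `|x| → ∞` and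
`|∇A|² ≤ ((2-α)/(N-α) + δ) a A` outside large balls for every `δ > 0`, then the
weighted energy estimates of Proposition 3.2 hold with the explicit decay rates
`-(N-α)/(2-α) - 2k + ε` and `-(N-α)/(2-α) - 2k - 1 + ε`. -/
theorem stmt13 (N : ℕ) (hN : 2 ≤ N) (Ω : Set (EuclideanSpace ℝ (Fin N)))
    (hΩopen : IsOpen Ω) (hΩconn : IsConnected Ω) (hΩcompl : IsCompact Ωᶜ)
    (hΩ0 : (0 : EuclideanSpace ℝ (Fin N)) ∉ closure Ω)
    (a : EuclideanSpace ℝ (Fin N) → ℝ) (ha2 : ContDiff ℝ 2 a) (ha_pos : ∀ x, 0 < a x)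
    (ha_rad : ∀ x y : EuclideanSpace ℝ (Fin N), ‖x‖ = ‖y‖ → a x = a y)
    (a₁ a₂ α : ℝ) (ha₁ : 0 < a₁) (ha₂ : 0 < a₂) (hα : 0 ≤ α ∧ α < 1)
    (ha_bd : ∀ x : EuclideanSpace ℝ (Fin N),
      a₁ * (1 + ‖x‖) ^ (-α) ≤ a x ∧ a x ≤ a₂ * (1 + ‖x‖) ^ (-α))
    (a₀ : ℝ) (ha₀ : 0 < a₀)
    (ha_lim : Filter.Tendsto (fun x : EuclideanSpace ℝ (Fin N) => ‖x‖ ^ α * a x)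
      (Filter.cocompact (EuclideanSpace ℝ (Fin N))) (nhds a₀))
    (A : EuclideanSpace ℝ (Fin N) → ℝ) (hA : ContDiff ℝ 2 A)
    (hPoisson : ∀ x, lap A x = a x)
    (A₁ A₂ : ℝ) (hA₁ : 0 < A₁) (hA₂ : 0 < A₂)
    (hA_bd : ∀ x : EuclideanSpace ℝ (Fin N),
      A₁ * (1 + ‖x‖) ^ (2 - α) ≤ A x ∧ A x ≤ A₂ * (1 + ‖x‖) ^ (2 - α))
    (hgrad : ∀ δ > (0 : ℝ), ∃ R > (0 : ℝ), ∀ x : EuclideanSpace ℝ (Fin N), R ≤ ‖x‖ →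
      ‖gradient A x‖ ^ 2 ≤ ((2 - α) / ((N : ℝ) - α) + δ) * a x * A x)
    (R₀ : ℝ) (hR₀ : 0 < R₀) :
    ∀ ε > (0 : ℝ), ∀ k : ℕ, ContDiff ℝ (max k 2 : ℕ) a →
    ∃ β > (0 : ℝ), ∃ c₀ ≥ (0 : ℝ), ∃ t₀ > (0 : ℝ), ∃ C > (0 : ℝ),
      ∀ u : EuclideanSpace ℝ (Fin N) → ℝ → ℝ,
        ContDiff ℝ (⊤ : ℕ∞) (fun p : EuclideanSpace ℝ (Fin N) × ℝ => u p.1 p.2) →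
        (∀ x ∈ Ω, ∀ s > (0 : ℝ),
          deriv (deriv (u x)) s - lap (fun y => u y s) x + a x * deriv (u x) s = 0) →
        (∀ x ∈ frontier Ω, ∀ s > (0 : ℝ), u x s = 0) →
        (∀ x : EuclideanSpace ℝ (Fin N), R₀ ≤ ‖x‖ → u x 0 = 0 ∧ deriv (u x) 0 = 0) →
        (∀ s ≥ (0 : ℝ), ∀ x : EuclideanSpace ℝ (Fin N), R₀ + s < ‖x‖ → u x s = 0) →
      ∀ t ≥ (0 : ℝ),
        (∫ x in Ω, Real.exp (β * (A x + c₀) / (1 + t)) * a x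
            * (deriv^[k] (u x) t) ^ 2)
          ≤ C * (t₀ + t) ^ (-(((N : ℝ) - α) / (2 - α)) - 2 * (k : ℝ) + ε) *
            ((∑ j ∈ Finset.range (k + 2),
                ∫ x in Ω, ‖iteratedFDeriv ℝ j (fun y => u y 0) x‖ ^ 2)
              + ∑ j ∈ Finset.range (k + 1),
                  ∫ x in Ω, ‖iteratedFDeriv ℝ j (fun y => deriv (u y) 0) x‖ ^ 2)
        ∧
        (∫ x in Ω, Real.exp (β * (A x + c₀) / (1 + t))
            * ‖gradient (fun y => deriv^[k] (u y) t) x‖ ^ 2)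
          ≤ C * (t₀ + t) ^ (-(((N : ℝ) - α) / (2 - α)) - 2 * (k : ℝ) - 1 + ε) *
            ((∑ j ∈ Finset.range (k + 2),
                ∫ x in Ω, ‖iteratedFDeriv ℝ j (fun y => u y 0) x‖ ^ 2)
              + ∑ j ∈ Finset.range (k + 1),
                  ∫ x in Ω, ‖iteratedFDeriv ℝ j (fun y => deriv (u y) 0) x‖ ^ 2) := by
  intro ε hε k hak
  obtain ⟨hα0, hα1⟩ := hα
  have hN' : (2 : ℝ) ≤ N := by exact_mod_cast hN
  set r := ((N : ℝ) - α) / (2 - α) with hr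
  have hr0 : 0 < r := div_pos (by linarith) (by linarith)
  have hr1 : (2 - α) / ((N : ℝ) - α) = 1 / r := by rw [hr, one_div_div]
  obtain ⟨m, β, δ, η, hm0, hmβ, hrm, hδ, hη0, hη1, hβh, hβh'⟩ := exists_decay_parameters hr0 hε
  have hβ0 : 0 < β := hm0.trans hmβ
  set h := 1 / r + δ with hh
  have hh0 : 0 < h := by positivity
  obtain ⟨R, hR, hgradR⟩ := hgrad δ hδ
  rw [hr1] at hgradR
  have hA1 : ContDiff ℝ 1 A := hA.of_le (by norm_num)
  obtain ⟨c₀, hc₀, hgradB⟩ := exists_shift ha₁ hα0 (fun x => (ha_bd x).1) hA1 hh0 hR hgradR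
  set ν := 2 * η / (m + 2 * k + 1) with hν
  have hν0 : 0 < ν := by positivity
  have hνM : (m + 2 * k + 1) * ν ≤ 2 * η := by
    rw [hν]
    exact le_of_eq (by field_simp)
  set K := (A₂ + c₀) * (1 + R₀) ^ 2 / a₁ with hK
  have hK0 : 0 ≤ K := by positivity
  have hβm : 0 < β - m := by linarith
  set S := (m + 2 * k + 1) * ν + β * K / η + (m + 2 * k) ^ 2 / (β - m) + 2 with hS
  have hS2 : 2 ≤ S := by
    have h1 : 0 ≤ (m + 2 * k + 1) * ν := by positivity
    have h2 : 0 ≤ β * K / η := by positivity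
    have h3 : 0 ≤ (m + 2 * k) ^ 2 / (β - m) := by positivity
    linarith
  set Λ := 1 + 2 / ν * S with hΛ
  have hνΛ : ν * Λ = ν + 2 * S := by rw [hΛ]; field_simp
  have hΛ1 : 1 ≤ Λ := by
    have : 0 ≤ 2 / ν * S := by positivity
    linarith
  obtain ⟨t₀, ht₀, hΛt⟩ := exists_time_shift ha₁ hα0 hα1 hR₀ (by linarith : 0 < Λ)
    (fun x => (ha_bd x).1)
  have H : IsAdmissible a (fun x => A x + c₀) R₀ β ν η h K Λ t₀ :=
    { cont_a := ha2.continuous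
      a_pos := ha_pos
      smooth_B := hA.add contDiff_const
      B_pos := fun x => add_pos_of_pos_of_nonneg
        ((mul_pos hA₁ (Real.rpow_pos_of_pos (by positivity) _)).trans_le (hA_bd x).1) hc₀
      lap_B := fun x => by rw [lap_add_const, hPoisson]
      grad_B := fun x => by simpa [partialD, fderiv_add_const] using hgradB x
      β_pos := hβ0
      ν_pos := hν0
      η_pos := hη0
      η_lt_one := hη1
      βh := hβh
      βh' := hβh'
      one_le_t₀ := ht₀
      one_le_Λ := hΛ1
      two_le := by linarith
      Λ_le := hΛt
      B_le := fun t ht x hx => shift_le ha₁ hA₂ hα1 hR₀ hc₀ (fun x => (ha_bd x).1)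
        (fun x => (hA_bd x).2) ht hx }
  obtain ⟨C, hC, hdecay⟩ := exists_weighted_decay (k := k) hΩopen H
    (hak.of_le (by exact_mod_cast le_max_left k 2)) hm0 hmβ hνM (by linarith)
    (p := -r - 2 * (k : ℝ) + ε) (by linarith)
  refine ⟨β, hβ0, c₀, hc₀, t₀, by linarith, C, hC, fun u hu heq hbd _ hsupp t ht => ?_⟩
  have hV := isDampedWave_uncurry hu heq hbd hsupp
  have hk := fun x => iterate_deriv_eq_iterate_timeD hu k x
  have h1 : ∀ x, deriv (u x) = fun t => timeD (fun p => u p.1 p.2) (x, t) :=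
    iterate_deriv_eq_iterate_timeD hu 1
  obtain ⟨d1, d2⟩ := hdecay _ hV t ht
  have e3 : -r - 2 * (k : ℝ) + ε - 1 = -r - 2 * (k : ℝ) - 1 + ε := by ring
  rw [e3] at d2
  simp only [hk, h1]
  refine ⟨le_of_eq_of_le ?_ d1, le_of_eq_of_le ?_ d2⟩
  · unfold weightedSq expWeight
    exact integral_congr_ae (Eventually.of_forall fun x => mul_assoc _ _ _)
  · unfold weightedGradSq expWeight gradSq
    refine integral_congr_ae (Eventually.of_forall fun x => ?_)
    simp only [norm_gradient_sq]
    congr 1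
    exact Finset.sum_congr rfl fun i _ => by
      rw [fderiv_slice_single (hV.iterate_timeD k).smooth.differentiable_of_top]
end

section
/- There exists a constant C > 0 such that for every s ≥ 0, ∫_Ω exp(−β A(x)/(1+s)) a(x)^{−1} dx ≤ C (1+s)^{(N+α)/(2−α)}. -/
open MeasureTheory Real

open Module in
/-- A stretched exponential of the norm times `1 + ‖y‖` is integrable. -/
theorem integrable_exp_neg_mul_norm_rpow_mul_one_add_norm {E : Type*} [NormedAddCommGroup E]
    [NormedSpace ℝ E] [FiniteDimensional ℝ E] [Nontrivial E] [MeasurableSpace E] [BorelSpace E]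
    (μ : Measure E) [μ.IsAddHaarMeasure] {c p : ℝ} (hc : 0 < c) (hp : 0 < p) :
    Integrable (fun y : E => Real.exp (-c * ‖y‖ ^ p) * (1 + ‖y‖)) μ := by
  refine (integrable_fun_norm_addHaar μ
    (f := fun r : ℝ => Real.exp (-c * r ^ p) * (1 + r))).2 ?_
  have key (k : ℕ) : IntegrableOn (fun r : ℝ => r ^ (k : ℝ) * Real.exp (-c * r ^ p))
      (Set.Ioi 0) :=
    integrableOn_rpow_mul_exp_neg_mul_rpow
      (neg_one_lt_zero.trans_le k.cast_nonneg) hp hc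
  refine ((key (finrank ℝ E - 1)).add (key (finrank ℝ E - 1 + 1))).congr_fun ?_ measurableSet_Ioi
  intro r _
  simp only [Pi.add_apply, Real.rpow_natCast, smul_eq_mul, pow_succ]
  ring

/-- The weight, rescaled by `l` with `l ^ p = T`, is controlled by a fixed profile. -/
theorem exp_mul_one_add_rpow_le {c p α T l r : ℝ} (hc : 0 ≤ c) (hp : 0 ≤ p) (hα : 0 ≤ α)
    (hα1 : α ≤ 1) (hl : 1 ≤ l) (hlT : l ^ p = T) (hr : 0 ≤ r) :
    Real.exp (-c * (1 + r) ^ p / T) * (1 + r) ^ α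
      ≤ l ^ α * (Real.exp (-c * (l⁻¹ * r) ^ p) * (1 + l⁻¹ * r)) := by
  have hl0 : 0 < l := by linarith
  have hq : 0 ≤ l⁻¹ * r := by positivity
  have hexp : Real.exp (-c * (1 + r) ^ p / T) ≤ Real.exp (-c * (l⁻¹ * r) ^ p) := by
    rw [Real.exp_le_exp, ← hlT, mul_div_assoc, ← Real.div_rpow (by positivity) hl0.le,
      neg_mul, neg_mul, neg_le_neg_iff]
    have : l⁻¹ * r ≤ (1 + r) / l := by
      rw [inv_mul_eq_div]; gcongr; linarith
    gcongr
  have hpow : (1 + r) ^ α ≤ l ^ α * (1 + l⁻¹ * r) := by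
    have h1 : 1 + r ≤ l * (1 + l⁻¹ * r) := by
      rw [mul_add, mul_inv_cancel_left₀ hl0.ne']; linarith
    calc (1 + r) ^ α ≤ (l * (1 + l⁻¹ * r)) ^ α := by gcongr
      _ = l ^ α * (1 + l⁻¹ * r) ^ α := Real.mul_rpow hl0.le (by positivity)
      _ ≤ l ^ α * (1 + l⁻¹ * r) ^ (1 : ℝ) := by
        gcongr; linarith
      _ = _ := by rw [Real.rpow_one]
  calc _ ≤ Real.exp (-c * (l⁻¹ * r) ^ p) * (l ^ α * (1 + l⁻¹ * r)) := by gcongr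
    _ = _ := by ring

/-- **Reciprocal-weight integral estimate (proof of Theorem 1.1, term J₃).**
There is `C > 0` with `∫_Ω exp(−βA(x)/(1+s)) a(x)⁻¹ dx ≤ C (1+s)^{(N+α)/(2−α)}`
for all `s ≥ 0`. -/
theorem stmt17 (N : ℕ) (hN : 2 ≤ N) (Ω : Set (EuclideanSpace ℝ (Fin N)))
    (hΩopen : IsOpen Ω) (hΩconn : IsConnected Ω) (hΩcompl : IsCompact Ωᶜ)
    (hΩ0 : (0 : EuclideanSpace ℝ (Fin N)) ∉ closure Ω)
    (a : EuclideanSpace ℝ (Fin N) → ℝ) (ha_cont : Continuous a) (ha_pos : ∀ x, 0 < a x)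
    (a₁ α : ℝ) (ha₁ : 0 < a₁) (hα : 0 ≤ α ∧ α < 1)
    (ha_lb : ∀ x : EuclideanSpace ℝ (Fin N), a₁ * (1 + ‖x‖) ^ (-α) ≤ a x)
    (A : EuclideanSpace ℝ (Fin N) → ℝ) (hA_cont : Continuous A)
    (A₁ : ℝ) (hA₁ : 0 < A₁)
    (hA_lb : ∀ x : EuclideanSpace ℝ (Fin N), A₁ * (1 + ‖x‖) ^ (2 - α) ≤ A x)
    (β : ℝ) (hβ : 0 < β) :
    ∃ C > (0 : ℝ), ∀ s ≥ (0 : ℝ),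
      (∫ x in Ω, Real.exp (-β * A x / (1 + s)) * (a x)⁻¹)
        ≤ C * (1 + s) ^ (((N : ℝ) + α) / (2 - α)) := by
  obtain ⟨hα0, hα1⟩ := hα
  have : NeZero N := ⟨by omega⟩
  have hp : 0 < 2 - α := by linarith
  have hc : 0 < β * A₁ := by positivity
  set g : EuclideanSpace ℝ (Fin N) → ℝ :=
    fun y => Real.exp (-(β * A₁) * ‖y‖ ^ (2 - α)) * (1 + ‖y‖) with hg
  have hgint : Integrable g :=
    integrable_exp_neg_mul_norm_rpow_mul_one_add_norm volume hc hp
  have hg0 (y) : 0 ≤ g y := by positivity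
  have hI : 0 ≤ ∫ y, g y := integral_nonneg hg0
  refine ⟨a₁⁻¹ * (∫ y, g y) + 1, by positivity, fun s hs => ?_⟩
  have hT : 1 ≤ 1 + s := by linarith
  have hT0 : 0 < 1 + s := by linarith
  set l : ℝ := (1 + s) ^ (1 / (2 - α)) with hl_def
  have hl : 1 ≤ l := Real.one_le_rpow hT (by positivity)
  have hl0 : 0 < l := by linarith
  have hlT : l ^ (2 - α) = 1 + s := by
    rw [hl_def, ← Real.rpow_mul hT0.le, one_div_mul_cancel hp.ne', Real.rpow_one]
  have hbound (x : EuclideanSpace ℝ (Fin N)) :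
      Real.exp (-β * A x / (1 + s)) * (a x)⁻¹ ≤ a₁⁻¹ * l ^ α * g (l⁻¹ • x) := by
    have hx : 0 < 1 + ‖x‖ := by positivity
    have hexp : Real.exp (-β * A x / (1 + s))
        ≤ Real.exp (-(β * A₁) * (1 + ‖x‖) ^ (2 - α) / (1 + s)) := by
      refine Real.exp_le_exp.2 (div_le_div_of_nonneg_right ?_ hT0.le)
      have := mul_le_mul_of_nonneg_left (hA_lb x) hβ.le
      linarith
    have hinv : (a x)⁻¹ ≤ a₁⁻¹ * (1 + ‖x‖) ^ α := by
      refine (inv_anti₀ (by positivity) (ha_lb x)).trans_eq ?_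
      rw [mul_inv, Real.rpow_neg hx.le, inv_inv]
    have hnorm : ‖l⁻¹ • x‖ = l⁻¹ * ‖x‖ := by
      rw [norm_smul, Real.norm_of_nonneg (by positivity)]
    calc _ ≤ Real.exp (-(β * A₁) * (1 + ‖x‖) ^ (2 - α) / (1 + s)) *
          (a₁⁻¹ * (1 + ‖x‖) ^ α) :=
          mul_le_mul hexp hinv (inv_nonneg.2 (ha_pos x).le) (Real.exp_pos _).le
      _ = a₁⁻¹ * (Real.exp (-(β * A₁) * (1 + ‖x‖) ^ (2 - α) / (1 + s)) *
          (1 + ‖x‖) ^ α) := by ring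
      _ ≤ a₁⁻¹ * (l ^ α * g (l⁻¹ • x)) := by
        simp only [hg, hnorm]
        exact mul_le_mul_of_nonneg_left
          (exp_mul_one_add_rpow_le hc.le hp.le hα0 hα1.le hl hlT (norm_nonneg x))
          (inv_nonneg.2 ha₁.le)
      _ = _ := by ring
  have hGint : Integrable (fun x => a₁⁻¹ * l ^ α * g (l⁻¹ • x)) :=
    (hgint.comp_smul (inv_ne_zero hl0.ne')).const_mul _
  have hpow : l ^ α * l ^ N = (1 + s) ^ (((N : ℝ) + α) / (2 - α)) := by
    rw [← Real.rpow_natCast, ← Real.rpow_add hl0, hl_def, ← Real.rpow_mul hT0.le]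
    congr 1
    ring
  calc (∫ x in Ω, Real.exp (-β * A x / (1 + s)) * (a x)⁻¹)
      ≤ ∫ x in Ω, a₁⁻¹ * l ^ α * g (l⁻¹ • x) :=
        integral_mono_of_nonneg
          (.of_forall fun x => mul_nonneg (Real.exp_pos _).le (inv_nonneg.2 (ha_pos x).le))
          hGint.integrableOn (.of_forall hbound)
    _ ≤ ∫ x, a₁⁻¹ * l ^ α * g (l⁻¹ • x) :=
        setIntegral_le_integral hGint
          (.of_forall fun x => mul_nonneg (by positivity) (hg0 _))
    _ = a₁⁻¹ * (∫ y, g y) * (l ^ α * l ^ N) := by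
        rw [integral_const_mul, Measure.integral_comp_inv_smul_of_nonneg _ _ hl0.le,
          finrank_euclideanSpace_fin, smul_eq_mul]
        ring
    _ ≤ (a₁⁻¹ * (∫ y, g y) + 1) * (1 + s) ^ (((N : ℝ) + α) / (2 - α)) := by
        rw [hpow]
        gcongr
        linarith
end

section
/- Let α ∈ [0,1) and let Φ : ℝ² ∖ {0} → ℝ² ∖ {0} be defined by Φ(x) := |x|^{−α/2} x; Φ is a bijection with inverse Φ^{−1}(y) = |y|^{α/(2−α)} y. Then for every smooth compactly supported function u : ℝ² → ℝ whose support does not contain 0, the function v := u ∘ Φ^{−1} satisfies ∫_{ℝ²} |∇v(y)|² dy ≤ (2/(2−α)) ∫_{ℝ²} |∇u(x)|² dx. -/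
open MeasureTheory Real

/-- Composition of two radial power maps. -/
theorem radial_rpow_comp {E : Type*} [NormedAddCommGroup E] [NormedSpace ℝ E] (a b : ℝ)
    {x : E} (hx : x ≠ 0) :
    ‖‖x‖ ^ a • x‖ ^ b • (‖x‖ ^ a • x) = ‖x‖ ^ ((a + 1) * b + a) • x := by
  have hn : 0 < ‖x‖ := norm_pos_iff.2 hx
  have h : ‖‖x‖ ^ a • x‖ = ‖x‖ ^ (a + 1) := by
    rw [norm_smul, Real.norm_of_nonneg (by positivity), Real.rpow_add_one hn.ne']
  rw [h, smul_smul, ← Real.rpow_mul hn.le, ← Real.rpow_add hn]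

/-- The scalar `c` plus the rank-one map `w ↦ d ⟪y, w⟫ y`. -/
noncomputable def scalarAddRankOne {E : Type*} [NormedAddCommGroup E] [InnerProductSpace ℝ E]
    (c d : ℝ) (y : E) : E →L[ℝ] E :=
  c • ContinuousLinearMap.id ℝ E + (d • innerSL ℝ y).smulRight y

theorem norm_scalarAddRankOne_le {E : Type*} [NormedAddCommGroup E] [InnerProductSpace ℝ E]
    {c d : ℝ} (hc : 0 ≤ c) (hd : 0 ≤ d) (y : E) :
    ‖scalarAddRankOne c d y‖ ≤ c + d * ‖y‖ ^ 2 := by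
  refine ContinuousLinearMap.opNorm_le_bound _ (by positivity) fun w => ?_
  simp only [scalarAddRankOne, add_apply, smul_apply,
    ContinuousLinearMap.id_apply, ContinuousLinearMap.smulRight_apply, innerSL_apply_apply,
    smul_eq_mul]
  refine (norm_add_le _ _).trans ?_
  rw [norm_smul, norm_smul, norm_mul, Real.norm_of_nonneg hc, Real.norm_of_nonneg hd]
  have h : d * ‖inner ℝ y w‖ * ‖y‖ ≤ d * (‖y‖ * ‖w‖) * ‖y‖ := by
    gcongr
    exact norm_inner_le_norm y w
  linarith

theorem det_scalarAddRankOne (c d : ℝ) (y : EuclideanSpace ℝ (Fin 2)) :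
    (scalarAddRankOne c d y).det = c * (c + d * ‖y‖ ^ 2) := by
  rw [ContinuousLinearMap.det,
    ← LinearMap.det_toMatrix (EuclideanSpace.basisFun (Fin 2) ℝ).toBasis, Matrix.det_fin_two]
  simp [LinearMap.toMatrix_apply, scalarAddRankOne, EuclideanSpace.real_norm_sq_eq,
    EuclideanSpace.inner_single_right]
  ring

theorem hasFDerivAt_radial_rpow {E : Type*} [NormedAddCommGroup E] [InnerProductSpace ℝ E]
    (b : ℝ) {y : E} (hy : y ≠ 0) :
    HasFDerivAt (fun z : E => ‖z‖ ^ b • z)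
      (scalarAddRankOne (‖y‖ ^ b) (b * ‖y‖ ^ (b - 2)) y) y := by
  have hpow (z : E) (t : ℝ) : (‖z‖ ^ 2) ^ t = ‖z‖ ^ (2 * t) := by
    rw [← Real.rpow_natCast, ← Real.rpow_mul (norm_nonneg z)]
    norm_num
  have h1 : HasFDerivAt (fun z : E => ‖z‖ ^ 2) (2 • innerSL ℝ y) y :=
    (hasStrictFDerivAt_norm_sq y).hasFDerivAt
  have h2 := h1.rpow_const (p := b / 2) (Or.inl (by positivity))
  simp only [hpow] at h2
  have h3 := h2.smul (hasFDerivAt_id y)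
  have e1 : 2 * (b / 2) = b := by ring
  have e2 : 2 * (b / 2 - 1) = b - 2 := by ring
  simp only [e1, e2] at h3
  refine h3.congr_fderiv (ContinuousLinearMap.ext fun w => ?_)
  simp [scalarAddRankOne]
  congr 1
  ring

/-- **Dirichlet-energy change of variables (proof of Lemma 2.5, N = 2).**
With `Φ(x) = |x|^{-α/2} x`, a bijection of `ℝ² ∖ {0}` with inverse
`Φ⁻¹(y) = |y|^{α/(2-α)} y`, for every smooth compactly supported `u` whose support
avoids `0`, the function `v = u ∘ Φ⁻¹` satisfies
`∫ |∇v|² dy ≤ (2/(2-α)) ∫ |∇u|² dx`. -/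
theorem stmt18 (α : ℝ) (hα : 0 ≤ α ∧ α < 1)
    (Φ Φinv : EuclideanSpace ℝ (Fin 2) → EuclideanSpace ℝ (Fin 2))
    (hΦ : ∀ x, Φ x = ‖x‖ ^ (-α / 2) • x)
    (hΦinv : ∀ y, Φinv y = ‖y‖ ^ (α / (2 - α)) • y) :
    (∀ x : EuclideanSpace ℝ (Fin 2), x ≠ 0 → Φinv (Φ x) = x ∧ Φ (Φinv x) = x) ∧
    ∀ u : EuclideanSpace ℝ (Fin 2) → ℝ, ContDiff ℝ (⊤ : ℕ∞) u →
      HasCompactSupport u → (0 : EuclideanSpace ℝ (Fin 2)) ∉ tsupport u →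
      (∫ y : EuclideanSpace ℝ (Fin 2), ‖fderiv ℝ (fun z => u (Φinv z)) y‖ ^ 2)
        ≤ (2 / (2 - α)) * ∫ x : EuclideanSpace ℝ (Fin 2), ‖fderiv ℝ u x‖ ^ 2 := by
  obtain ⟨h0, h1⟩ := hα
  have h2 : (2 - α) ≠ 0 := by linarith
  obtain rfl : Φ = fun x => ‖x‖ ^ (-α / 2) • x := funext hΦ
  set b : ℝ := α / (2 - α) with hb
  have hb0 : 0 ≤ b := div_nonneg h0 (by linarith)
  have hbα : 2 / (2 - α) = 1 + b := by rw [hb]; field_simp; ring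
  obtain rfl : Φinv = fun y => ‖y‖ ^ b • y := funext hΦinv
  have hinv : ∀ x : EuclideanSpace ℝ (Fin 2), x ≠ 0 →
      ‖‖x‖ ^ (-α / 2) • x‖ ^ b • (‖x‖ ^ (-α / 2) • x) = x ∧
      ‖‖x‖ ^ b • x‖ ^ (-α / 2) • (‖x‖ ^ b • x) = x := by
    intro x hx
    rw [radial_rpow_comp _ _ hx, radial_rpow_comp _ _ hx]
    have e1 : (-α / 2 + 1) * b + -α / 2 = 0 := by rw [hb]; field_simp; ring
    have e2 : (b + 1) * (-α / 2) + b = 0 := by rw [hb]; field_simp; ring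
    simp [e1, e2]
  refine ⟨hinv, fun u hu hcu _ => ?_⟩
  have hne (a : ℝ) {x : EuclideanSpace ℝ (Fin 2)} (hx : x ≠ 0) : ‖x‖ ^ a • x ≠ 0 :=
    smul_ne_zero (Real.rpow_pos_of_pos (norm_pos_iff.2 hx) a).ne' hx
  let s : Set (EuclideanSpace ℝ (Fin 2)) := {0}ᶜ
  let Ψ : EuclideanSpace ℝ (Fin 2) → EuclideanSpace ℝ (Fin 2) := fun y => ‖y‖ ^ b • y
  let L : EuclideanSpace ℝ (Fin 2) → EuclideanSpace ℝ (Fin 2) →L[ℝ] EuclideanSpace ℝ (Fin 2) :=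
    fun y => scalarAddRankOne (‖y‖ ^ b) (b * ‖y‖ ^ (b - 2)) y
  let g : EuclideanSpace ℝ (Fin 2) → ℝ := fun x => ‖fderiv ℝ u x‖ ^ 2
  have hs : MeasurableSet s := (measurableSet_singleton 0).compl
  have hsvol : volume.restrict s = volume :=
    Measure.restrict_eq_self_of_ae_mem (compl_mem_ae_iff.2 (measure_singleton 0))
  have hL : ∀ y ∈ s, HasFDerivAt Ψ (L y) y := fun y hy => hasFDerivAt_radial_rpow b hy
  have hinj : Set.InjOn Ψ s := fun x hx y hy hxy => by
    rw [← (hinv x hx).2, ← (hinv y hy).2]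
    exact congrArg (fun z => ‖z‖ ^ (-α / 2) • z) hxy
  have himg : Ψ '' s = s := by
    ext x
    constructor
    · rintro ⟨y, hy, rfl⟩
      exact hne b hy
    · intro hx
      exact ⟨_, hne (-α / 2) hx, (hinv x hx).1⟩
  have hgi : Integrable g := by
    have hcont : Continuous (fderiv ℝ u) := hu.continuous_fderiv (by simp)
    refine Continuous.integrable_of_hasCompactSupport (by fun_prop) ?_
    exact (hcu.fderiv ℝ).comp_left (g := fun T => ‖T‖ ^ 2) (by simp)
  have hcov := integral_image_eq_integral_abs_det_fderiv_smul volume hs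
    (fun y hy => (hL y hy).hasFDerivWithinAt) hinj g
  have hint := (integrableOn_image_iff_integrableOn_abs_det_fderiv_smul volume hs
    (fun y hy => (hL y hy).hasFDerivWithinAt) hinj g).1 hgi.integrableOn
  rw [himg, hsvol] at hcov
  rw [IntegrableOn, hsvol] at hint
  change _ ≤ _ * ∫ x, g x
  rw [hcov, hbα, ← integral_const_mul]
  refine integral_mono_of_nonneg (.of_forall fun _ => by positivity) (hint.const_mul _) ?_
  filter_upwards [compl_mem_ae_iff.2 (measure_singleton (0 : EuclideanSpace ℝ (Fin 2)))] with y hy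
  have hn : 0 < ‖y‖ := norm_pos_iff.2 hy
  have hchain : fderiv ℝ (fun z => u (Ψ z)) y = (fderiv ℝ u (Ψ y)).comp (L y) :=
    ((hu.differentiable (by simp) (Ψ y)).hasFDerivAt.comp y (hL y hy)).fderiv
  have hd : b * ‖y‖ ^ (b - 2) * ‖y‖ ^ 2 = b * ‖y‖ ^ b := by
    rw [mul_assoc, ← Real.rpow_natCast ‖y‖ 2, ← Real.rpow_add hn]
    norm_num
  have hdet : |(L y).det| = (1 + b) * (‖y‖ ^ b) ^ 2 := by
    rw [det_scalarAddRankOne, hd, abs_of_nonneg (by positivity)]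
    ring
  have hnorm : ‖L y‖ ≤ (1 + b) * ‖y‖ ^ b := by
    refine (norm_scalarAddRankOne_le (by positivity) (by positivity) y).trans_eq ?_
    rw [hd]
    ring
  change ‖fderiv ℝ (fun z => u (Ψ z)) y‖ ^ 2 ≤ (1 + b) * (|(L y).det| * ‖fderiv ℝ u (Ψ y)‖ ^ 2)
  rw [hchain, hdet]
  calc ‖(fderiv ℝ u (Ψ y)).comp (L y)‖ ^ 2
      ≤ (‖fderiv ℝ u (Ψ y)‖ * ((1 + b) * ‖y‖ ^ b)) ^ 2 := by
        gcongr
        exact (ContinuousLinearMap.opNorm_comp_le _ _).trans (by gcongr)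
    _ = _ := by ring
end
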